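/- Let n ≥ 2, set d = n(2n+1), let a_j = n−j+1/2 for 1 ≤ j ≤ n, let ρ = (n−1/2, n−3/2, …, 1/2) ∈ ℝⁿ, and define the multiplicity polynomial m(x) = (∏_{i=1}^n x_i²) ∏_{1≤i<l≤n} (x_i² − x_l²)² / ((∏_{j=1}^n a_j²) ∏_{1≤j<l≤n} (a_j² − a_l²)²) for x ∈ ℝⁿ. Define, for λ > 0, 𝓝(λ) = (1/(2^{n} n!)) Σ_{b∈ℤⁿ} m(b+ρ) · 1_{|b+ρ|² ≤ λ + |ρ|²}. Then as λ → ∞, 𝓝(λ) = C λ^{d/2} + O(λ^{α}), where C = (1/(2^{n} n!)) ∫_{|x|≤1} m(x) dx and α = (2n³ + 3n² − n)/(2(n+1)). In particular α < (d−1)/2, so the Avakumovic–Hörmander remainder exponent (d−1)/2 in Weyl's law is not sharp for this counting function (which is the spectral counting function of the Laplace–Beltrami operator on SO(2n+1) with its bi-invariant metric). -/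

import Mathlib

open MeasureTheory Filter Asymptotics Finset

section Poisson

variable {ι : Type*} [Fintype ι]

lemma finite_int_norm_le (R : ℝ) : {b : ι → ℤ | ‖fun i => (b i : ℝ)‖ ≤ R}.Finite := by
  classical
  refine (Set.finite_Icc (fun _ : ι => -⌈R⌉) (fun _ => ⌈R⌉)).subset fun b hb => ?_
  have h : ∀ i, |(b i : ℝ)| ≤ R := fun i => (norm_le_pi_norm (fun i => (b i : ℝ)) i).trans hb
  refine ⟨fun i => ?_, fun i => ?_⟩
  · have h1 : (-(b i) : ℝ) ≤ ⌈R⌉ := ((neg_le_abs _).trans (h i)).trans (Int.le_ceil R)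
    have h2 : -(b i) ≤ ⌈R⌉ := by exact_mod_cast h1
    change -⌈R⌉ ≤ b i
    omega
  · have h1 : (b i : ℝ) ≤ ⌈R⌉ := ((le_abs_self _).trans (h i)).trans (Int.le_ceil R)
    exact_mod_cast h1

/-- **Poisson summation** on `ℤⁿ` for continuous compactly supported functions with summable
Fourier coefficients. -/
theorem poisson_summation_pi (F : (ι → ℝ) → ℂ) (hc : Continuous F) (hs : HasCompactSupport F)
    (hsum : Summable fun ξ : ι → ℤ =>
      ∫ x : ι → ℝ, Complex.exp (-(2 * Real.pi * Complex.I * ∑ i, (ξ i : ℂ) * (x i : ℂ))) * F x)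
    (x : ι → ℝ) :
    HasSum (fun ξ : ι → ℤ =>
      (∫ x : ι → ℝ, Complex.exp (-(2 * Real.pi * Complex.I * ∑ i, (ξ i : ℂ) * (x i : ℂ))) * F x) *
        Complex.exp (2 * Real.pi * Complex.I * ∑ i, (ξ i : ℂ) * (x i : ℂ)))
      (∑' b : ι → ℤ, F (fun i => x i + b i)) := by
  classical
  obtain ⟨M, hM⟩ := hs.isCompact.isBounded.exists_norm_le
  have hF0 : ∀ y, M < ‖y‖ → F y = 0 := fun y hy => by
    by_contra h
    exact absurd (hM y (subset_tsupport _ h)) (not_le.mpr hy)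
  have hbnd : ∀ (y : ι → ℝ) (b : ι → ℤ), F (fun i => y i + b i) ≠ 0 →
      ‖fun i => (b i : ℝ)‖ ≤ M + ‖y‖ := fun y b h => by
    have h1 : ‖fun i => y i + b i‖ ≤ M := by
      by_contra h2
      exact h (hF0 _ (not_le.mp h2))
    have h3 : (fun i => (b i : ℝ)) = (fun i => y i + (b i : ℝ)) - y := by ext i; simp
    rw [h3]
    exact (norm_sub_le _ _).trans (by gcongr)
  have hfin : ∀ y : ι → ℝ, (Function.support fun b : ι → ℤ => F (fun i => y i + b i)).Finite :=
    fun y => (finite_int_norm_le (M + ‖y‖)).subset fun b hb => hbnd y b hb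
  set P : (ι → ℝ) → ℂ := fun y => ∑' b : ι → ℤ, F (fun i => y i + b i) with hP
  have hPc : Continuous P := by
    have : P = fun y => ∑ᶠ b : ι → ℤ, F (fun i => y i + b i) := by
      ext y; exact tsum_eq_finsum (hfin y)
    rw [this]
    refine continuous_finsum (fun b => hc.comp (by fun_prop)) fun y => ?_
    refine ⟨Metric.ball y 1, Metric.ball_mem_nhds _ one_pos, ?_⟩
    refine (finite_int_norm_le (M + (‖y‖ + 1))).subset ?_
    rintro b ⟨z, hz, hz'⟩
    refine (hbnd z b hz).trans ?_
    have : ‖z - y‖ < 1 := by simpa [dist_eq_norm] using hz'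
    have := norm_le_norm_add_norm_sub' z y
    linarith
  have hPper : ∀ (y : ι → ℝ) (b : ι → ℤ), P (fun i => y i + b i) = P y := fun y b => by
    simp only [hP]
    rw [← (Equiv.addRight b).tsum_eq (fun c : ι → ℤ => F (fun i => y i + c i))]
    refine tsum_congr fun c => ?_
    congr 1; ext i
    push_cast [Pi.add_apply, Equiv.coe_addRight]
    ring
  let q : C(ι → ℝ, UnitAddTorus ι) :=
    ⟨fun y i => (y i : UnitAddCircle), by
      exact continuous_pi fun i => (AddCircle.continuous_mk' 1).comp (continuous_apply i)⟩
  have hq : IsOpenQuotientMap q :=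
    IsOpenQuotientMap.piMap (fun i : ι => QuotientAddGroup.isOpenQuotientMap_mk)
  have hlift : ∀ y z, q y = q z → P y = P z := fun y z h => by
    have : ∀ i, ∃ k : ℤ, y i - z i = k := fun i => by
      have := congrFun h i
      obtain ⟨k, hk⟩ := AddCircle.coe_eq_zero_iff (p := (1:ℝ)) |>.mp
        (show ((y i - z i : ℝ) : UnitAddCircle) = 0 by
          rw [AddCircle.coe_sub]; exact sub_eq_zero.mpr this)
      exact ⟨k, by simpa using hk.symm⟩
    choose k hk using this
    rw [← hPper z k]
    congr 1; ext i
    linarith [hk i]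
  let G : C(UnitAddTorus ι, ℂ) := hq.isQuotientMap.lift ⟨P, hPc⟩ (fun y z h => hlift y z h)
  have hG : ∀ y, G (q y) = P y := fun y => by
    have := hq.isQuotientMap.lift_comp ⟨P, hPc⟩ (fun y z h => hlift y z h)
    exact DFunLike.congr_fun this y
  have hmF : ∀ (ξ : ι → ℤ) (y : ι → ℝ), UnitAddTorus.mFourier ξ (q y) =
      Complex.exp (2 * Real.pi * Complex.I * ∑ i, (ξ i : ℂ) * (y i : ℂ)) := fun ξ y => by
    simp only [UnitAddTorus.mFourier, ContinuousMap.coe_mk, q, fourier_coe_apply]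
    rw [Finset.mul_sum, Complex.exp_sum]
    refine Finset.prod_congr rfl fun i _ => ?_
    congr 1; push_cast; ring
  have hcoef : ∀ ξ : ι → ℤ, UnitAddTorus.mFourierCoeff G ξ =
      ∫ x : ι → ℝ, Complex.exp (-(2 * Real.pi * Complex.I * ∑ i, (ξ i : ℂ) * (x i : ℂ))) * F x := by
    intro ξ
    set e : (ι → ℝ) → ℂ := fun x =>
      Complex.exp (-(2 * Real.pi * Complex.I * ∑ i, (ξ i : ℂ) * (x i : ℂ))) with he
    have hec : Continuous e := by fun_prop
    have heper : ∀ (y : ι → ℝ) (b : ι → ℤ), e (fun i => y i + b i) = e y := fun y b => by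
      simp only [he]
      rw [Complex.exp_eq_exp_iff_exists_int]
      refine ⟨-∑ i, ξ i * b i, ?_⟩
      push_cast
      simp only [mul_add, Finset.sum_add_distrib]
      ring
    have hfi : Integrable (fun x => e x * F x) :=
      (hec.mul hc).integrable_of_hasCompactSupport hs.mul_left
    rw [UnitAddTorus.mFourierCoeff_eq_integral _ _ (fun _ => (0:ℝ))]
    set Q : (ι → ℤ) → Set (ι → ℝ) := fun b => {x | ∀ i, x i ∈ Set.Ioc (b i : ℝ) (b i + 1)} with hQ
    have hQm : ∀ b, MeasurableSet (Q b) := fun b =>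
      MeasurableSet.univ_pi' (fun i => measurableSet_Ioc)
    have hQd : Pairwise (Function.onFun Disjoint Q) := fun b c hbc => by
      rw [Function.onFun, Set.disjoint_left]
      intro y hy hy'
      apply hbc
      ext i
      have h1 := hy i
      have h2 := hy' i
      have h3 : (b i : ℝ) < c i + 1 := h1.1.trans_le h2.2
      have h4 : (c i : ℝ) < b i + 1 := h2.1.trans_le h1.2
      have h5 : b i < c i + 1 := by exact_mod_cast h3
      have h6 : c i < b i + 1 := by exact_mod_cast h4
      omega
    have hQu : (⋃ b, Q b) = Set.univ := by
      refine Set.eq_univ_of_forall fun y => Set.mem_iUnion.mpr ⟨fun i => ⌈y i⌉ - 1, fun i => ?_⟩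
      have := Int.ceil_lt_add_one (y i)
      have := Int.le_ceil (y i)
      push_cast
      constructor <;> linarith
    have h1 := (hasSum_integral_iUnion hQm hQd (f := fun x => e x * F x) hfi.integrableOn).tsum_eq
    rw [hQu, setIntegral_univ] at h1
    rw [← h1]
    have hQ0 : {x : ι → ℝ | ∀ i, x i ∈ Set.Ioc (0:ℝ) (0 + 1)} = Q 0 := by simp [hQ]
    have hshift : ∀ b : ι → ℤ, ∫ x in Q b, e x * F x =
        ∫ x in Q 0, e x * F (fun i => x i + b i) := fun b => by
      have hmp := measurePreserving_add_right (volume : Measure (ι → ℝ)) (fun i => (b i : ℝ))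
      have := hmp.setIntegral_preimage_emb
        (MeasurableEquiv.addRight (fun i => (b i : ℝ))).measurableEmbedding
        (fun x => e x * F x) (Q b)
      rw [← this]
      have hpre : (fun x : ι → ℝ => x + fun i => (b i : ℝ)) ⁻¹' Q b = Q 0 := by
        ext y
        refine forall_congr' fun i => ?_
        simp only [Set.mem_Ioc, Pi.add_apply, Pi.zero_apply, Int.cast_zero]
        constructor <;> rintro ⟨h1, h2⟩ <;> constructor <;> linarith
      rw [hpre]
      refine integral_congr_ae (Eventually.of_forall fun y => ?_)
      have := heper y b
      simp only [Pi.add_def]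
      rw [this]
    simp_rw [hshift]
    rw [hQ0]
    set S := (finite_int_norm_le (ι := ι) (M + 1)).toFinset with hS
    have hzero : ∀ b ∉ S, ∀ y ∈ Q 0, F (fun i => y i + b i) = 0 := fun b hb y hy => by
      by_contra h
      apply hb
      rw [hS, Set.Finite.mem_toFinset]
      refine (hbnd y b h).trans ?_
      gcongr
      rw [pi_norm_le_iff_of_nonneg zero_le_one]
      intro i
      have := hy i
      simp only [Pi.zero_apply, Int.cast_zero, zero_add] at this
      rw [Real.norm_eq_abs, abs_le]
      constructor <;> linarith [this.1, this.2]
    rw [tsum_eq_sum (s := S)]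
    · rw [← integral_finsetSum]
      · refine setIntegral_congr_fun (hQm 0) fun y hy => ?_
        change UnitAddTorus.mFourier (-ξ) (q y) • G (q y) = _
        rw [hG, hmF, ← Finset.mul_sum, smul_eq_mul, hP]
        simp only
        rw [tsum_eq_sum (s := S) (fun b hb => hzero b hb y hy)]
        congr 2
        simp
      · intro b _
        have : Integrable (fun x => e x * F (fun i => x i + b i)) := by
          have h := hfi.comp_add_right (fun i => (b i : ℝ))
          refine h.congr (Eventually.of_forall fun y => ?_)
          have := heper y b
          simp only [Pi.add_def]
          rw [this]
        exact this.integrableOn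
    · intro b hb
      rw [setIntegral_congr_fun (g := fun _ => 0) (hQm 0)]
      · simp
      · intro y hy
        simp [hzero b hb y hy]
  have hfinal := UnitAddTorus.hasSum_mFourier_series_apply_of_summable (f := G)
    (by simpa only [funext hcoef] using hsum) (q x)
  simp only [hcoef, hmF, hG, smul_eq_mul] at hfinal
  exact hfinal

end Poisson

section Oscillatory

lemma Polynomial.exists_abs_eval_le (q : Polynomial ℝ) :
    ∃ M, 0 ≤ M ∧ ∀ t : ℝ, |t| ≤ 1 → |q.eval t| ≤ M := by
  obtain ⟨M, hM⟩ := (isCompact_Icc (a := (-1:ℝ)) (b := 1)).exists_bound_of_continuousOn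
    q.continuous.continuousOn
  refine ⟨M, (norm_nonneg _).trans (hM 0 (by norm_num)), fun t ht => hM t (abs_le.mp ht)⟩

lemma norm_cexp_neg_mul_I (τ t : ℝ) : ‖Complex.exp (-(τ * t * Complex.I))‖ = 1 := by
  have : -((τ : ℂ) * t * Complex.I) = ((-(τ * t) : ℝ) : ℂ) * Complex.I := by push_cast; ring
  rw [this, Complex.norm_exp_ofReal_mul_I]

lemma integral_truncated_rpow_le {μ s : ℝ} (hμ : μ < -1) (hs : 0 < s) (hs' : s ≤ 1 / 2) :
    ∫ t in (-1 + s)..(1 - s), ((1 - t) ^ μ + (1 + t) ^ μ) ≤ 2 * (s ^ (μ + 1) / (-(μ + 1))) := by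
  have h0 : (0:ℝ) ∉ Set.uIcc s (2 - s) := by
    rw [Set.uIcc_of_le (by linarith)]; intro h; linarith [h.1]
  have key : ∫ v in s..(2 - s), v ^ μ ≤ s ^ (μ + 1) / (-(μ + 1)) := by
    rw [integral_rpow (Or.inr ⟨by linarith, h0⟩), div_neg, ← neg_div, div_le_div_right_of_neg
      (by linarith)]
    have : 0 ≤ (2 - s) ^ (μ + 1) := Real.rpow_nonneg (by linarith) _
    linarith
  have i1 : IntervalIntegrable (fun t : ℝ => (1 - t) ^ μ) volume (-1 + s) (1 - s) := by
    refine ContinuousOn.intervalIntegrable fun t ht => ?_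
    rw [Set.uIcc_of_le (by linarith)] at ht
    exact (ContinuousAt.rpow_const (by fun_prop) (Or.inl (by linarith [ht.2]))).continuousWithinAt
  have i2 : IntervalIntegrable (fun t : ℝ => (1 + t) ^ μ) volume (-1 + s) (1 - s) := by
    refine ContinuousOn.intervalIntegrable fun t ht => ?_
    rw [Set.uIcc_of_le (by linarith)] at ht
    exact (ContinuousAt.rpow_const (by fun_prop) (Or.inl (by linarith [ht.1]))).continuousWithinAt
  rw [intervalIntegral.integral_add i1 i2]
  have e1 := intervalIntegral.integral_comp_sub_left (a := -1 + s) (b := 1 - s)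
    (fun v : ℝ => v ^ μ) 1
  have e2 := intervalIntegral.integral_comp_add_left (a := -1 + s) (b := 1 - s)
    (fun v : ℝ => v ^ μ) 1
  rw [show (1:ℝ) - (1 - s) = s by ring, show (1:ℝ) - (-1 + s) = 2 - s by ring] at e1
  rw [show (1:ℝ) + (-1 + s) = s by ring, show (1:ℝ) + (1 - s) = 2 - s by ring] at e2
  rw [e1, e2]
  linarith

lemma one_sub_sq_rpow_le {μ t : ℝ} (hμ : μ ≤ 0) (h1 : -1 < t) (h2 : t < 1) :
    (1 - t ^ 2) ^ μ ≤ (1 - t) ^ μ + (1 + t) ^ μ := by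
  have p1 : 0 ≤ (1 - t) ^ μ := Real.rpow_nonneg (by linarith) _
  have p2 : 0 ≤ (1 + t) ^ μ := Real.rpow_nonneg (by linarith) _
  rcases le_total 0 t with h | h
  · have := Real.rpow_le_rpow_of_nonpos (x := 1 - t) (y := 1 - t ^ 2) (by linarith)
      (by nlinarith) hμ
    linarith
  · have := Real.rpow_le_rpow_of_nonpos (x := 1 + t) (y := 1 - t ^ 2) (by linarith)
      (by nlinarith) hμ
    linarith

lemma truncated_integral_bound (N : ℕ) : ∀ μ : ℝ, μ < (N : ℝ) - 1 → ∀ q : Polynomial ℝ,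
    ∃ C, 0 ≤ C ∧ ∀ τ : ℝ, 2 ≤ τ →
      ‖∫ t in (-1 + τ⁻¹)..(1 - τ⁻¹), ((q.eval t * (1 - t ^ 2) ^ μ : ℝ) : ℂ) *
        Complex.exp (-(τ * t * Complex.I))‖ ≤ C * τ⁻¹ ^ (μ + 1) := by
  induction N with
  | zero =>
    intro μ hμ q
    simp only [Nat.cast_zero, zero_sub] at hμ
    obtain ⟨M, hM0, hM⟩ := q.exists_abs_eval_le
    refine ⟨M * (2 / (-(μ + 1))), mul_nonneg hM0 (div_nonneg two_pos.le (by linarith)),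
      fun τ hτ => ?_⟩
    have hs : 0 < τ⁻¹ := by positivity
    have hs' : τ⁻¹ ≤ 1 / 2 := by rw [inv_le_comm₀ (by linarith) (by norm_num)]; linarith
    set s := τ⁻¹
    have hle : -1 + s ≤ 1 - s := by linarith
    calc _ ≤ ∫ t in (-1 + s)..(1 - s), M * ((1 - t) ^ μ + (1 + t) ^ μ) := by
          refine intervalIntegral.norm_integral_le_of_norm_le hle
            (Eventually.of_forall fun t ht => ?_) ?_
          · have h1 : -1 < t := by linarith [ht.1]
            have h2 : t < 1 := by linarith [ht.2]
            rw [norm_mul, norm_cexp_neg_mul_I, mul_one, Complex.norm_real, norm_mul,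
              Real.norm_eq_abs, Real.norm_eq_abs]
            have h3 : 0 ≤ (1 - t ^ 2) ^ μ := Real.rpow_nonneg (by nlinarith) _
            rw [abs_of_nonneg h3]
            exact mul_le_mul (hM t (abs_le.mpr ⟨h1.le, h2.le⟩))
              (one_sub_sq_rpow_le (by linarith) h1 h2) h3 hM0
          · refine ContinuousOn.intervalIntegrable fun t ht => ?_
            rw [Set.uIcc_of_le hle] at ht
            refine ContinuousAt.continuousWithinAt (continuousAt_const.mul (.add ?_ ?_))
            · exact ContinuousAt.rpow_const (by fun_prop) (Or.inl (by linarith [ht.2]))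
            · exact ContinuousAt.rpow_const (by fun_prop) (Or.inl (by linarith [ht.1]))
      _ ≤ M * (2 * (s ^ (μ + 1) / (-(μ + 1)))) := by
          rw [intervalIntegral.integral_const_mul]
          exact mul_le_mul_of_nonneg_left (integral_truncated_rpow_le hμ hs hs') hM0
      _ = _ := by ring
  | succ N ih =>
    intro μ hμ q
    set q' : Polynomial ℝ := q.derivative * (1 - Polynomial.X ^ 2) -
      Polynomial.C (2 * μ) * Polynomial.X * q with hq'
    obtain ⟨C, hC0, hC⟩ := ih (μ - 1) (by push_cast at hμ; linarith) q'
    obtain ⟨M, hM0, hM⟩ := q.exists_abs_eval_le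
    refine ⟨2 * M * 2 ^ |μ| + C, by positivity, fun τ hτ => ?_⟩
    have hτ0 : 0 < τ := by linarith
    have hs : 0 < τ⁻¹ := by positivity
    have hs' : τ⁻¹ ≤ 1 / 2 := by rw [inv_le_comm₀ (by linarith) (by norm_num)]; linarith
    specialize hC τ hτ
    set s := τ⁻¹ with hsdef
    have hle : -1 + s ≤ 1 - s := by linarith
    have hτC : (τ : ℂ) ≠ 0 := by simp [hτ0.ne']
    set u : ℝ → ℂ := fun t => ((q.eval t * (1 - t ^ 2) ^ μ : ℝ) : ℂ) with hu
    set u' : ℝ → ℂ := fun t => ((q'.eval t * (1 - t ^ 2) ^ (μ - 1) : ℝ) : ℂ) with hu'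
    set v : ℝ → ℂ := fun t => -(Complex.exp (-(τ * t * Complex.I)) / (τ * Complex.I)) with hv
    set v' : ℝ → ℂ := fun t => Complex.exp (-(τ * t * Complex.I)) with hv'
    have hpos : ∀ t ∈ Set.uIcc (-1 + s) (1 - s), 0 < 1 - t ^ 2 := fun t ht => by
      rw [Set.uIcc_of_le hle] at ht
      nlinarith [ht.1, ht.2]
    have hdu : ∀ t ∈ Set.uIcc (-1 + s) (1 - s), HasDerivAt u (u' t) t := fun t ht => by
      have h0 := hpos t ht
      have h1 : HasDerivAt (fun t : ℝ => 1 - t ^ 2) (-(2 * t)) t := by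
        have := (hasDerivAt_pow 2 t).const_sub 1
        convert! this using 1; norm_num
      have h2 := (q.hasDerivAt t).mul (h1.rpow_const (p := μ) (Or.inl h0.ne'))
      have h3 := h2.ofReal_comp
      convert! h3 using 1
      simp only [hu', hq']
      congr 1
      have h4 : (1 - t ^ 2) ^ μ = (1 - t ^ 2) * (1 - t ^ 2) ^ (μ - 1) := by
        rw [Real.rpow_sub_one h0.ne']; field_simp
      rw [h4]
      simp only [Polynomial.eval_sub, Polynomial.eval_mul, Polynomial.eval_one,
        Polynomial.eval_pow, Polynomial.eval_X, Polynomial.eval_C]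
      ring
    have hdv : ∀ t ∈ Set.uIcc (-1 + s) (1 - s), HasDerivAt v (v' t) t := fun t _ => by
      have h1 : HasDerivAt (fun t : ℝ => -((τ:ℂ) * t * Complex.I)) (-(τ * Complex.I)) t := by
        have := (((hasDerivAt_id t).ofReal_comp.const_mul (τ:ℂ)).mul_const Complex.I).neg
        simpa using! this
      have h2 := (h1.cexp.div_const (τ * Complex.I)).neg
      convert! h2 using 1
      simp only [hv']
      field_simp
    have hcu' : ContinuousOn u' (Set.uIcc (-1 + s) (1 - s)) := fun t ht => by
      refine (Complex.continuous_ofReal.continuousAt.comp (f := fun t : ℝ =>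
        q'.eval t * (1 - t ^ 2) ^ (μ - 1)) ?_).continuousWithinAt
      refine q'.continuous.continuousAt.mul ?_
      exact ContinuousAt.rpow_const (by fun_prop) (Or.inl (hpos t ht).ne')
    have hcv' : Continuous v' := by fun_prop
    have hparts := intervalIntegral.integral_mul_deriv_eq_deriv_mul hdu hdv
      hcu'.intervalIntegrable (hcv'.intervalIntegrable _ _)
    have hvn : ∀ t, ‖v t‖ = s := fun t => by
      simp only [hv, norm_neg, norm_div, norm_cexp_neg_mul_I, norm_mul, Complex.norm_I, mul_one,
        Complex.norm_real, Real.norm_eq_abs, abs_of_pos hτ0, one_div, hsdef]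
    have hun : ∀ t, t ^ 2 = (1 - s) ^ 2 → ‖u t‖ ≤ M * (2 ^ |μ| * s ^ μ) := fun t ht => by
      have ht1 : |t| ≤ 1 := by
        rw [← sq_le_one_iff_abs_le_one, ht]; nlinarith
      simp only [hu, Complex.norm_real, norm_mul, Real.norm_eq_abs]
      have h1 : 1 - t ^ 2 = s * (2 - s) := by rw [ht]; ring
      rw [h1, Real.mul_rpow hs.le (by linarith), abs_mul,
        abs_of_nonneg (Real.rpow_nonneg hs.le _), abs_of_nonneg (Real.rpow_nonneg (by linarith) _)]
      refine mul_le_mul (hM t ht1) ?_ (by have : 0 ≤ 2 - s := by linarith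
                                          positivity) hM0
      rw [mul_comm]
      refine mul_le_mul_of_nonneg_right ?_ (Real.rpow_nonneg hs.le _)
      calc (2 - s) ^ μ ≤ (2 - s) ^ |μ| :=
            Real.rpow_le_rpow_of_exponent_le (by linarith) (le_abs_self _)
        _ ≤ 2 ^ |μ| := Real.rpow_le_rpow (by linarith) (by linarith) (abs_nonneg _)
    have hfi : ‖∫ t in (-1 + s)..(1 - s), u' t * v t‖ ≤ s * (C * s ^ (μ - 1 + 1)) := by
      have : ∀ t, u' t * v t = -(1 / (τ * Complex.I)) * (u' t * v' t) := fun t => by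
        simp only [hv, hv']; ring
      simp_rw [this]
      rw [intervalIntegral.integral_const_mul, norm_mul]
      have hn : ‖-(1 / ((τ:ℂ) * Complex.I))‖ = s := by
        simp [abs_of_pos hτ0, hsdef]
      rw [hn]
      exact mul_le_mul_of_nonneg_left hC hs.le
    have hsμ : s * s ^ μ = s ^ (μ + 1) := by rw [Real.rpow_add_one hs.ne']; ring
    calc _ = ‖∫ t in (-1 + s)..(1 - s), u t * v' t‖ := rfl
      _ ≤ ‖u (1 - s) * v (1 - s)‖ + ‖u (-1 + s) * v (-1 + s)‖ +
          ‖∫ t in (-1 + s)..(1 - s), u' t * v t‖ := by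
          rw [hparts]
          exact (norm_sub_le _ _).trans (by gcongr; exact norm_sub_le _ _)
      _ ≤ M * (2 ^ |μ| * s ^ μ) * s + M * (2 ^ |μ| * s ^ μ) * s + s * (C * s ^ (μ - 1 + 1)) := by
          rw [norm_mul, norm_mul, hvn, hvn]
          have a1 := hun (1 - s) rfl
          have a2 := hun (-1 + s) (by ring)
          gcongr
      _ = _ := by
          rw [sub_add_cancel, ← hsμ]; ring

lemma integral_one_sub_sq_rpow_bound {μ : ℝ} (hμ : 0 ≤ μ) :
    ∃ C, 0 ≤ C ∧ ∀ τ : ℝ, 2 ≤ τ →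
      ‖∫ t in (-1)..1, (((1 - t ^ 2) ^ μ : ℝ) : ℂ) * Complex.exp (-(τ * t * Complex.I))‖
        ≤ C * τ⁻¹ ^ (μ + 1) := by
  obtain ⟨N, hN⟩ := exists_nat_gt (μ + 1)
  obtain ⟨C, hC0, hC⟩ := truncated_integral_bound N μ (by linarith) 1
  refine ⟨C + 2 * 2 ^ μ, by positivity, fun τ hτ => ?_⟩
  have hs : 0 < τ⁻¹ := by positivity
  have hs' : τ⁻¹ ≤ 1 / 2 := by rw [inv_le_comm₀ (by linarith) (by norm_num)]; linarith
  specialize hC τ hτ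
  simp only [Polynomial.eval_one, one_mul] at hC
  set s := τ⁻¹ with hsdef
  set f : ℝ → ℂ := fun t => (((1 - t ^ 2) ^ μ : ℝ) : ℂ) * Complex.exp (-(τ * t * Complex.I))
  have hf : Continuous f := by
    refine .mul (Complex.continuous_ofReal.comp ?_) (by fun_prop)
    exact Continuous.rpow_const (by fun_prop) fun t => Or.inr hμ
  have hend : ∀ a b : ℝ, a ≤ b → b - a = s → (∀ t ∈ Set.Icc a b, 0 ≤ 1 - t ^ 2 ∧ 1 - t ^ 2 ≤ 2 * s) →
      ‖∫ t in a..b, f t‖ ≤ 2 ^ μ * s ^ (μ + 1) := fun a b hab hba h => by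
    have := intervalIntegral.norm_integral_le_of_norm_le_const (a := a) (b := b) (f := f)
      (C := (2 * s) ^ μ) fun t ht => by
        rw [Set.uIoc_of_le hab] at ht
        have h1 := h t ⟨ht.1.le, ht.2⟩
        simp only [f, norm_mul, norm_cexp_neg_mul_I, mul_one, Complex.norm_real]
        rw [Real.norm_of_nonneg (Real.rpow_nonneg h1.1 _)]
        exact Real.rpow_le_rpow h1.1 h1.2 hμ
    refine this.trans (le_of_eq ?_)
    rw [hba, abs_of_pos hs, Real.mul_rpow two_pos.le hs.le, Real.rpow_add_one hs.ne']
    ring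
  have hi : ∀ a b : ℝ, IntervalIntegrable f volume a b := fun a b => hf.intervalIntegrable a b
  rw [← intervalIntegral.integral_add_adjacent_intervals (hi (-1) (1 - s)) (hi (1 - s) 1),
    ← intervalIntegral.integral_add_adjacent_intervals (hi (-1) (-1 + s)) (hi (-1 + s) (1 - s))]
  have e1 := hend (-1) (-1 + s) (by linarith) (by ring) fun t ht =>
    ⟨by nlinarith [ht.1, ht.2], by nlinarith [ht.1, ht.2]⟩
  have e2 := hend (1 - s) 1 (by linarith) (by ring) fun t ht =>
    ⟨by nlinarith [ht.1, ht.2], by nlinarith [ht.1, ht.2]⟩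
  calc _ ≤ _ + _ + _ := norm_add₃_le
    _ ≤ 2 ^ μ * s ^ (μ + 1) + C * s ^ (μ + 1) + 2 ^ μ * s ^ (μ + 1) := by gcongr
    _ = _ := by ring

end Oscillatory

section PosPow

lemma hasDerivAt_max_zero_rpow {μ : ℝ} (hμ : 0 < μ) (w : ℝ) :
    HasDerivAt (fun w : ℝ => max w 0 ^ (μ + 1)) ((μ + 1) * max w 0 ^ μ) w := by
  rcases lt_trichotomy w 0 with h | rfl | h
  · rw [max_eq_right h.le, Real.zero_rpow hμ.ne', mul_zero]
    refine (hasDerivAt_const w (0:ℝ)).congr_of_eventuallyEq ?_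
    filter_upwards [Iio_mem_nhds h] with v hv
    rw [max_eq_right (le_of_lt hv), Real.zero_rpow (by positivity)]
  · rw [max_self, Real.zero_rpow hμ.ne', mul_zero, hasDerivAt_iff_isLittleO]
    simp only [max_self, Real.zero_rpow (show μ + 1 ≠ 0 by positivity), sub_zero, smul_zero]
    rw [Asymptotics.isLittleO_iff]
    intro c hc
    have hcont : Tendsto (fun w : ℝ => max w 0 ^ μ) (nhds 0) (nhds 0) := by
      have : Continuous fun w : ℝ => max w 0 ^ μ :=
        Continuous.rpow_const (by fun_prop) fun _ => Or.inr hμ.le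
      simpa [Real.zero_rpow hμ.ne'] using this.tendsto 0
    filter_upwards [hcont.eventually (gt_mem_nhds hc)] with v hv
    have h1 : 0 ≤ max v 0 := le_max_right _ _
    rw [Real.rpow_add_one' h1 (by positivity), norm_mul, Real.norm_of_nonneg (Real.rpow_nonneg h1 _),
      Real.norm_of_nonneg h1]
    refine mul_le_mul hv.le ?_ h1 hc.le
    exact max_le (le_abs_self _) (abs_nonneg _)
  · rw [max_eq_left h.le]
    have := Real.hasDerivAt_rpow_const (x := w) (p := μ + 1) (Or.inl h.ne')
    rw [add_sub_cancel_right] at this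
    refine this.congr_of_eventuallyEq ?_
    filter_upwards [Ioi_mem_nhds h] with v hv
    rw [max_eq_left (le_of_lt hv)]

/-- The Fourier transform at frequency `r` of `t ↦ (Λ - t²)₊ ^ μ`. -/
noncomputable def besselIntegral (μ r Λ : ℝ) : ℂ :=
  ∫ t : ℝ, ((max (Λ - t ^ 2) 0 ^ μ : ℝ) : ℂ) * Complex.exp (-((2 * Real.pi * r : ℝ) * t * Complex.I))

lemma continuous_max_sub_sq_rpow {μ : ℝ} (hμ : 0 ≤ μ) (Λ : ℝ) :
    Continuous fun t : ℝ => max (Λ - t ^ 2) 0 ^ μ :=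
  Continuous.rpow_const (by fun_prop) fun _ => Or.inr hμ

lemma hasCompactSupport_max_sub_sq_rpow {μ : ℝ} (hμ : 0 < μ) (Λ : ℝ) :
    HasCompactSupport fun t : ℝ => max (Λ - t ^ 2) 0 ^ μ := by
  refine HasCompactSupport.intro (isCompact_closedBall (0:ℝ) √Λ) fun t ht => ?_
  have h1 : √Λ < |t| := by simpa using ht
  have h2 : Λ ≤ t ^ 2 := by
    rw [← sq_abs]
    rcases le_total Λ 0 with h | h
    · exact h.trans (sq_nonneg _)
    · rw [← Real.sq_sqrt h]; gcongr
  rw [max_eq_right (by linarith), Real.zero_rpow hμ.ne']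

lemma integrable_max_sub_sq_rpow {μ : ℝ} (hμ : 0 < μ) (Λ : ℝ) :
    Integrable fun t : ℝ => max (Λ - t ^ 2) 0 ^ μ :=
  (continuous_max_sub_sq_rpow hμ.le Λ).integrable_of_hasCompactSupport
    (hasCompactSupport_max_sub_sq_rpow hμ Λ)

lemma hasDerivAt_besselIntegral {μ : ℝ} (hμ : 0 < μ) (r Λ : ℝ) :
    HasDerivAt (besselIntegral (μ + 1) r) ((μ + 1 : ℝ) * besselIntegral μ r Λ) Λ := by
  have hE : Continuous fun t : ℝ => Complex.exp (-((2 * Real.pi * r : ℝ) * t * Complex.I)) := by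
    fun_prop
  have hc : ∀ {ν : ℝ}, 0 < ν → ∀ L : ℝ, Continuous fun t : ℝ => ((max (L - t ^ 2) 0 ^ ν : ℝ) : ℂ) *
      Complex.exp (-((2 * Real.pi * r : ℝ) * t * Complex.I)) := fun hν L =>
    (Complex.continuous_ofReal.comp (continuous_max_sub_sq_rpow hν.le L)).mul hE
  have hfi : ∀ {ν : ℝ}, 0 < ν → ∀ L : ℝ, Integrable fun t : ℝ =>
      ((max (L - t ^ 2) 0 ^ ν : ℝ) : ℂ) *
        Complex.exp (-((2 * Real.pi * r : ℝ) * t * Complex.I)) := fun {ν} hν L =>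
    (integrable_max_sub_sq_rpow hν L).mono (hc hν L).aestronglyMeasurable
      (Eventually.of_forall fun t => by
        rw [norm_mul, norm_cexp_neg_mul_I, mul_one, Complex.norm_real])
  have := hasDerivAt_integral_of_dominated_loc_of_deriv_le (μ := (volume : Measure ℝ)) (𝕜 := ℝ)
    (F := fun L t => ((max (L - t ^ 2) 0 ^ (μ + 1) : ℝ) : ℂ) *
        Complex.exp (-((2 * Real.pi * r : ℝ) * t * Complex.I)))
    (F' := fun L t => (((μ + 1) * max (L - t ^ 2) 0 ^ μ : ℝ) : ℂ) *
        Complex.exp (-((2 * Real.pi * r : ℝ) * t * Complex.I)))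
    (x₀ := Λ) (s := Metric.ball Λ 1) (Metric.ball_mem_nhds Λ one_pos)
    (bound := fun t => (μ + 1) * max (Λ + 1 - t ^ 2) 0 ^ μ)
    (Eventually.of_forall fun L => (hc (by positivity) L).aestronglyMeasurable)
    (hfi (by positivity) Λ) ?_ ?_ ?_ ?_
  · have h2 := this.2
    refine h2.congr_deriv ?_
    rw [besselIntegral, ← integral_const_mul]
    refine integral_congr_ae (Eventually.of_forall fun t => ?_)
    push_cast
    ring
  · refine Continuous.aestronglyMeasurable (.mul (Complex.continuous_ofReal.comp ?_) hE)
    exact continuous_const.mul (continuous_max_sub_sq_rpow hμ.le Λ)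
  · refine Eventually.of_forall fun t L hL => ?_
    rw [norm_mul, norm_cexp_neg_mul_I, mul_one, Complex.norm_real, norm_mul,
      Real.norm_of_nonneg (by positivity), Real.norm_of_nonneg (by positivity)]
    have : L ≤ Λ + 1 := by
      have := (abs_lt.mp (by simpa [Real.dist_eq] using hL : |L - Λ| < 1)).2
      linarith
    gcongr
  · exact (integrable_max_sub_sq_rpow hμ _).const_mul _
  · refine Eventually.of_forall fun t L _ => ?_
    have h1 := (hasDerivAt_max_zero_rpow hμ (L - t ^ 2)).comp L
      ((hasDerivAt_id L).sub_const (t ^ 2))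
    have h2 := h1.ofReal_comp.mul_const (Complex.exp (-((2 * Real.pi * r : ℝ) * t * Complex.I)))
    simpa using! h2

lemma besselIntegral_eq {μ : ℝ} (hμ : 0 < μ) (r : ℝ) {Λ : ℝ} (hΛ : 0 < Λ) :
    besselIntegral μ r Λ = ((√Λ * Λ ^ μ : ℝ) : ℂ) *
      ∫ t in (-1)..1, (((1 - t ^ 2) ^ μ : ℝ) : ℂ) *
        Complex.exp (-((2 * Real.pi * r * √Λ : ℝ) * t * Complex.I)) := by
  have hs : 0 < √Λ := Real.sqrt_pos.mpr hΛ
  have h1 := Measure.integral_comp_mul_left (fun t : ℝ => ((max (Λ - t ^ 2) 0 ^ μ : ℝ) : ℂ) *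
    Complex.exp (-((2 * Real.pi * r : ℝ) * t * Complex.I))) √Λ
  rw [abs_of_pos (inv_pos.mpr hs)] at h1
  have h2 : besselIntegral μ r Λ = (√Λ : ℝ) • ∫ t : ℝ,
      ((max (Λ - (√Λ * t) ^ 2) 0 ^ μ : ℝ) : ℂ) *
        Complex.exp (-((2 * Real.pi * r : ℝ) * ((√Λ * t : ℝ) : ℂ) * Complex.I)) := by
    rw [h1, smul_smul, mul_inv_cancel₀ hs.ne', one_smul]; rfl
  rw [h2, intervalIntegral.integral_of_le (by norm_num), Complex.real_smul,
    Complex.ofReal_mul √Λ (Λ ^ μ), mul_assoc ((√Λ : ℝ) : ℂ)]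
  congr 1
  rw [← integral_const_mul, ← integral_indicator measurableSet_Ioc]
  refine integral_congr_ae (Eventually.of_forall fun t => ?_)
  have h3 : Λ - (√Λ * t) ^ 2 = Λ * (1 - t ^ 2) := by
    rw [mul_pow, Real.sq_sqrt hΛ.le]; ring
  simp only [h3]
  by_cases ht : t ∈ Set.Ioc (-1:ℝ) 1
  · rw [Set.indicator_of_mem ht]
    have h4 : 0 ≤ 1 - t ^ 2 := by nlinarith [ht.1, ht.2]
    rw [max_eq_left (by positivity), Real.mul_rpow hΛ.le h4]
    push_cast
    rw [mul_assoc]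
    congr 3
    ring_nf
  · rw [Set.indicator_of_notMem ht]
    have h4 : 1 - t ^ 2 ≤ 0 := by
      rw [Set.mem_Ioc, not_and_or, not_lt, not_le] at ht
      rcases ht with h | h <;> nlinarith
    rw [max_eq_right (by nlinarith), Real.zero_rpow hμ.ne']
    simp

lemma besselIntegral_bound {μ : ℝ} (hμ : 0 < μ) :
    ∃ C, 0 ≤ C ∧ ∀ r Λ : ℝ, 1 ≤ r → 1 ≤ Λ →
      ‖besselIntegral μ r Λ‖ ≤ C * (Λ ^ (μ / 2) * r ^ (-(μ + 1))) := by
  obtain ⟨C, hC0, hC⟩ := integral_one_sub_sq_rpow_bound hμ.le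
  refine ⟨C, hC0, fun r Λ hr hΛ => ?_⟩
  have hΛ0 : 0 < Λ := by linarith
  have hr0 : 0 < r := by linarith
  have hs : 1 ≤ √Λ := Real.one_le_sqrt.mpr hΛ
  have hrs : 1 ≤ r * √Λ := by nlinarith
  have hpi := Real.pi_gt_three
  have hτ : r * √Λ ≤ 2 * Real.pi * r * √Λ := by nlinarith
  have hτ2 : 2 ≤ 2 * Real.pi * r * √Λ := by nlinarith
  rw [besselIntegral_eq hμ r hΛ0, norm_mul, Complex.norm_real,
    Real.norm_of_nonneg (by positivity)]
  calc _ ≤ (√Λ * Λ ^ μ) * (C * (2 * Real.pi * r * √Λ)⁻¹ ^ (μ + 1)) := by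
        gcongr; exact hC _ hτ2
    _ ≤ (√Λ * Λ ^ μ) * (C * (r * √Λ)⁻¹ ^ (μ + 1)) := by gcongr
    _ = _ := by
        rw [Real.inv_rpow (by positivity), Real.mul_rpow (by positivity) (by positivity),
          Real.rpow_neg hr0.le, Real.sqrt_eq_rpow, ← Real.rpow_mul hΛ0.le]
        have : Λ ^ (1 / 2 : ℝ) * Λ ^ μ = Λ ^ (μ / 2) * Λ ^ (1 / 2 * (μ + 1)) := by
          rw [← Real.rpow_add hΛ0, ← Real.rpow_add hΛ0]; congr 1; ring
        rw [this]
        field_simp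

end PosPow

section Slicing

lemma integral_inner_norm_eq_of_norm_eq {E : Type*} [NormedAddCommGroup E] [InnerProductSpace ℝ E]
    [FiniteDimensional ℝ E] [MeasurableSpace E] [BorelSpace E] {ξ η : E} (h : ‖ξ‖ = ‖η‖)
    (G : ℝ → ℝ → ℂ) :
    ∫ x : E, G (inner ℝ ξ x) ‖x‖ = ∫ x : E, G (inner ℝ η x) ‖x‖ := by
  set R : E ≃ₗᵢ[ℝ] E := (ℝ ∙ (ξ - η))ᗮ.reflection with hR
  have hRξ : R ξ = η := Submodule.reflection_sub h
  have := (R.measurePreserving).integral_comp R.toHomeomorph.measurableEmbedding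
    (fun x : E => G (inner ℝ η x) ‖x‖)
  rw [← this]
  refine integral_congr_ae (Eventually.of_forall fun x => ?_)
  simp only [R.norm_map]
  rw [← hRξ, R.inner_map_map]

/-- The Fourier transform on `ι → ℝ`, for the standard Euclidean pairing. -/
noncomputable def piFourier {ι : Type*} [Fintype ι] (F : (ι → ℝ) → ℝ) (ξ : ι → ℝ) : ℂ :=
  ∫ x : ι → ℝ, Complex.exp (-(2 * Real.pi * Complex.I * ∑ i, (ξ i : ℂ) * (x i : ℂ))) * (F x : ℂ)

lemma integral_max_sub_sum_sq_pow (m j : ℕ) (hj : 1 ≤ j) (w : ℝ) :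
    ∫ y : Fin m → ℝ, max (w - ∑ i, y i ^ 2) 0 ^ j =
      max w 0 ^ ((j : ℝ) + m / 2) * ∫ y : Fin m → ℝ, max (1 - ∑ i, y i ^ 2) 0 ^ j := by
  have hj' : (1:ℝ) ≤ j := by exact_mod_cast hj
  rcases le_or_gt w 0 with hw | hw
  · rw [max_eq_right hw, Real.zero_rpow (by positivity), zero_mul]
    refine integral_eq_zero_of_ae (Eventually.of_forall fun y => ?_)
    have : 0 ≤ ∑ i, y i ^ 2 := Finset.sum_nonneg fun i _ => sq_nonneg _
    simp only [Pi.zero_apply]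
    rw [max_eq_right (by linarith), zero_pow (by omega)]
  · have hs : 0 < √w := Real.sqrt_pos.mpr hw
    have h1 := Measure.integral_comp_smul (volume : Measure (Fin m → ℝ))
      (fun y => max (w - ∑ i, y i ^ 2) 0 ^ j) √w
    have h2 : ∀ y : Fin m → ℝ, max (w - ∑ i, (√w • y) i ^ 2) 0 ^ j =
        w ^ j * max (1 - ∑ i, y i ^ 2) 0 ^ j := fun y => by
      have : w - ∑ i, (√w • y) i ^ 2 = w * (1 - ∑ i, y i ^ 2) := by
        simp only [Pi.smul_apply, smul_eq_mul, mul_pow, Real.sq_sqrt hw.le]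
        rw [← Finset.mul_sum]; ring
      rw [this, ← mul_pow, mul_max_of_nonneg _ _ hw.le, mul_zero]
    simp only [h2] at h1
    rw [integral_const_mul, Module.finrank_fin_fun, abs_of_pos (by positivity), smul_eq_mul] at h1
    have h3 : √w ^ m * (√w ^ m)⁻¹ = 1 := mul_inv_cancel₀ (by positivity)
    calc _ = √w ^ m * ((√w ^ m)⁻¹ * ∫ y : Fin m → ℝ, max (w - ∑ i, y i ^ 2) 0 ^ j) := by
          rw [← mul_assoc, h3, one_mul]
      _ = _ := by
          rw [← h1, max_eq_left hw.le, Real.rpow_add hw, Real.rpow_natCast, Real.sqrt_eq_rpow,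
            ← Real.rpow_natCast, ← Real.rpow_mul hw.le]
          ring_nf

lemma continuous_max_sub_sum_sq_pow {ι : Type*} [Fintype ι] (j : ℕ) (Λ : ℝ) :
    Continuous fun x : ι → ℝ => max (Λ - ∑ i, x i ^ 2) 0 ^ j := by fun_prop

lemma hasCompactSupport_max_sub_sum_sq_pow {ι : Type*} [Fintype ι] {j : ℕ} (hj : 1 ≤ j) (Λ : ℝ) :
    HasCompactSupport fun x : ι → ℝ => max (Λ - ∑ i, x i ^ 2) 0 ^ j := by
  refine HasCompactSupport.intro (isCompact_closedBall (0 : ι → ℝ) √Λ) fun x hx => ?_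
  have h1 : √Λ < ‖x‖ := by simpa using hx
  have : ∃ i, √Λ < |x i| := by
    by_contra! h
    exact absurd ((pi_norm_le_iff_of_nonneg (Real.sqrt_nonneg _)).mpr h) (not_le.mpr h1)
  obtain ⟨i, hi⟩ := this
  have h2 : Λ ≤ x i ^ 2 := by
    rw [← sq_abs]
    rcases le_total Λ 0 with h | h
    · exact h.trans (sq_nonneg _)
    · rw [← Real.sq_sqrt h]; gcongr
  have h3 : x i ^ 2 ≤ ∑ i, x i ^ 2 :=
    Finset.single_le_sum (f := fun i => x i ^ 2) (fun i _ => sq_nonneg _) (Finset.mem_univ i)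
  rw [max_eq_right (by linarith), zero_pow (by omega)]

lemma norm_cexp_piFourier {ι : Type*} [Fintype ι] (ξ x : ι → ℝ) :
    ‖Complex.exp (-(2 * Real.pi * Complex.I * ∑ i, (ξ i : ℂ) * (x i : ℂ)))‖ = 1 := by
  have : -(2 * Real.pi * Complex.I * ∑ i, (ξ i : ℂ) * (x i : ℂ)) =
      ((-(2 * Real.pi * ∑ i, ξ i * x i) : ℝ) : ℂ) * Complex.I := by push_cast; ring
  rw [this, Complex.norm_exp_ofReal_mul_I]

lemma integrable_piFourier {ι : Type*} [Fintype ι] {F : (ι → ℝ) → ℝ} (hc : Continuous F)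
    (hs : HasCompactSupport F) (ξ : ι → ℝ) :
    Integrable fun x : ι → ℝ =>
      Complex.exp (-(2 * Real.pi * Complex.I * ∑ i, (ξ i : ℂ) * (x i : ℂ))) * (F x : ℂ) := by
  refine (hc.integrable_of_hasCompactSupport hs).mono (by fun_prop) ?_
  refine Eventually.of_forall fun x => ?_
  rw [norm_mul, norm_cexp_piFourier, one_mul, Complex.norm_real]

lemma piFourier_max_sub_sum_sq_pow (m j : ℕ) (hj : 1 ≤ j) (Λ : ℝ) (ξ : Fin (m + 1) → ℝ) :
    piFourier (fun x => max (Λ - ∑ i, x i ^ 2) 0 ^ j) ξ =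
      ((∫ y : Fin m → ℝ, max (1 - ∑ i, y i ^ 2) 0 ^ j : ℝ) : ℂ) *
        besselIntegral ((j : ℝ) + m / 2) (√(∑ i, ξ i ^ 2)) Λ := by
  set r := √(∑ i, ξ i ^ 2) with hr
  -- rotate `ξ` to the first coordinate axis
  have hrot : piFourier (fun x => max (Λ - ∑ i, x i ^ 2) 0 ^ j) ξ =
      piFourier (fun x => max (Λ - ∑ i, x i ^ 2) 0 ^ j) (Pi.single (0 : Fin (m + 1)) r) := by
    have key : ∀ ζ : Fin (m + 1) → ℝ, piFourier (fun x => max (Λ - ∑ i, x i ^ 2) 0 ^ j) ζ =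
        ∫ x : EuclideanSpace ℝ (Fin (m + 1)), Complex.exp (-(2 * Real.pi * Complex.I *
          ((inner ℝ (WithLp.toLp 2 ζ) x : ℝ) : ℂ))) * ((max (Λ - ‖x‖ ^ 2) 0 ^ j : ℝ) : ℂ) := by
      intro ζ
      rw [piFourier, ← (PiLp.volume_preserving_toLp (Fin (m + 1))).integral_comp
        (MeasurableEquiv.toLp 2 _).measurableEmbedding]
      refine integral_congr_ae (Eventually.of_forall fun x => ?_)
      simp only [EuclideanSpace.norm_sq_eq, PiLp.inner_apply, Real.norm_eq_abs, sq_abs]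
      simp [mul_comm]
    rw [key, key]
    refine integral_inner_norm_eq_of_norm_eq ?_ (fun u v => Complex.exp (-(2 * Real.pi * Complex.I *
          (u : ℂ))) * ((max (Λ - v ^ 2) 0 ^ j : ℝ) : ℂ))
    rw [EuclideanSpace.norm_eq, EuclideanSpace.norm_eq]
    simp only [Real.norm_eq_abs, sq_abs]
    rw [← hr, Fin.sum_univ_succ]
    simp [Real.sqrt_sq (Real.sqrt_nonneg _), hr]
  rw [hrot, piFourier]
  have hmp := (volume_preserving_piFinSuccAbove (fun _ : Fin (m + 1) => ℝ) 0).symm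
  have hfi := integrable_piFourier (continuous_max_sub_sum_sq_pow j Λ)
    (hasCompactSupport_max_sub_sum_sq_pow hj Λ) (Pi.single (0 : Fin (m + 1)) r)
  rw [← hmp.integral_comp (MeasurableEquiv.measurableEmbedding _)]
  have hfi2 := (hmp.integrable_comp_emb (MeasurableEquiv.measurableEmbedding _)).mpr hfi
  rw [Measure.volume_eq_prod] at hfi2 ⊢
  simp only [Function.comp_def] at hfi2
  rw [integral_prod _ hfi2, besselIntegral, ← integral_const_mul]
  refine integral_congr_ae (Eventually.of_forall fun t => ?_)
  simp only
  have hpt : ∀ y : Fin m → ℝ, ∑ i, (((MeasurableEquiv.piFinSuccAbove (fun _ : Fin (m + 1) => ℝ) 0).symm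
      (t, y)) i) ^ 2 = t ^ 2 + ∑ i, y i ^ 2 := fun y => by
    rw [Fin.sum_univ_succ]
    simp [MeasurableEquiv.piFinSuccAbove]
  have hpt2 : ∀ y : Fin m → ℝ, ∑ i, ((Pi.single (0 : Fin (m + 1)) r : Fin (m + 1) → ℝ) i : ℂ) *
      ((((MeasurableEquiv.piFinSuccAbove (fun _ : Fin (m + 1) => ℝ) 0).symm
      (t, y)) i : ℝ) : ℂ) = r * t := fun y => by
    rw [Fin.sum_univ_succ]
    simp [MeasurableEquiv.piFinSuccAbove]
  simp only [hpt, hpt2]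
  rw [integral_const_mul, integral_complex_ofReal]
  have := integral_max_sub_sum_sq_pow m j hj (Λ - t ^ 2)
  simp only [sub_sub] at this
  rw [this]
  have he : -(2 * (Real.pi : ℂ) * Complex.I * (r * t)) =
      -((2 * Real.pi * r : ℝ) * t * Complex.I) := by push_cast; ring
  rw [he, Complex.ofReal_mul (max (Λ - t ^ 2) 0 ^ ((j : ℝ) + m / 2))]
  ring

end Slicing

section Differences

lemma hasDerivAt_fwdDiff_iter {V : Type*} [NormedAddCommGroup V] [NormedSpace ℝ V]
    {f f' : ℝ → V} (hf : ∀ x, HasDerivAt f (f' x) x) (h : ℝ) (k : ℕ) :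
    ∀ x, HasDerivAt ((fwdDiff h)^[k] f) ((fwdDiff h)^[k] f' x) x := by
  induction k generalizing f f' with
  | zero => simpa using hf
  | succ k ih =>
    rw [Function.iterate_succ_apply, Function.iterate_succ_apply]
    refine ih fun x => ?_
    exact ((hf (x + h)).comp_add_const x h).sub (hf x)

lemma norm_fwdDiff_iter_le {V : Type*} [NormedAddCommGroup V] (f : ℝ → V) {h : ℝ} (hh : 0 ≤ h)
    (k : ℕ) {M x : ℝ} (hM : ∀ y ∈ Set.Icc x (x + k * h), ‖f y‖ ≤ M) :
    ‖(fwdDiff h)^[k] f x‖ ≤ 2 ^ k * M := by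
  induction k generalizing x with
  | zero => simpa using hM x (by simp)
  | succ k ih =>
    push_cast at hM
    rw [Function.iterate_succ_apply']
    have h1 := ih (x := x) fun y hy => hM y ⟨hy.1, by nlinarith [hy.2]⟩
    have h2 := ih (x := x + h) fun y hy => hM y ⟨by linarith [hy.1], by nlinarith [hy.2]⟩
    refine (norm_sub_le _ _).trans ?_
    rw [pow_succ]
    linarith

lemma norm_fwdDiff_iter_le_of_hasDerivAt (f : ℕ → ℝ → ℂ) (c : ℕ → ℝ)
    (hf : ∀ j x, HasDerivAt (f (j + 1)) (c j * f j x) x) {h : ℝ} (hh : 0 ≤ h)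
    (k : ℕ) {M x : ℝ} (hM : ∀ y ∈ Set.Icc x (x + k * h), ‖f 0 y‖ ≤ M) :
    ‖(fwdDiff h)^[k] (f k) x‖ ≤ (∏ j ∈ range k, |c j|) * h ^ k * M := by
  induction k generalizing x with
  | zero => simpa using hM x (by simp)
  | succ k ih =>
    push_cast at hM
    rw [Function.iterate_succ_apply']
    have hd := hasDerivAt_fwdDiff_iter (hf k) h k
    have hsm : (fun x => (c k : ℂ) * f k x) = (c k : ℂ) • f k := rfl
    rw [hsm, fwdDiff_iter_const_smul] at hd
    have := norm_image_sub_le_of_norm_deriv_le_segment' (a := x) (b := x + h)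
      (C := |c k| * ((∏ j ∈ range k, |c j|) * h ^ k * M))
      (fun y _ => (hd y).hasDerivWithinAt) (fun y hy => ?_) (x + h) ⟨by linarith, le_rfl⟩
    · refine this.trans (le_of_eq ?_)
      rw [Finset.prod_range_succ]; ring
    · rw [Pi.smul_apply, norm_smul, Complex.norm_real, Real.norm_eq_abs]
      gcongr
      exact ih fun z hz => hM z ⟨by linarith [hz.1, hy.1], by nlinarith [hz.2, hy.2]⟩

/-- The truncated power `w₊ ^ j / j!`. -/
noncomputable def truncPow (j : ℕ) (w : ℝ) : ℝ := max w 0 ^ j / j.factorial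

lemma hasDerivAt_truncPow {j : ℕ} (hj : 1 ≤ j) (w : ℝ) :
    HasDerivAt (truncPow (j + 1)) (truncPow j w) w := by
  have hj' : (0:ℝ) < j := by exact_mod_cast hj
  have h1 := (hasDerivAt_max_zero_rpow hj' w).div_const ((j + 1).factorial : ℝ)
  have h2 : (fun w : ℝ => max w 0 ^ ((j : ℝ) + 1) / ((j + 1).factorial : ℝ)) = truncPow (j + 1) := by
    ext w
    rw [truncPow, ← Real.rpow_natCast]; push_cast; rfl
  rw [h2] at h1
  refine h1.congr_deriv ?_
  rw [truncPow, Real.rpow_natCast, Nat.factorial_succ]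
  push_cast
  field_simp

lemma continuous_truncPow (j : ℕ) : Continuous (truncPow j) := by
  unfold truncPow; fun_prop

lemma fwdDiff_iter_truncPow {h : ℝ} (hh : 0 < h) (k : ℕ) (hk : 1 ≤ k) (w : ℝ) :
    0 ≤ (fwdDiff h)^[k] (truncPow k) w ∧ (fwdDiff h)^[k] (truncPow k) w ≤ h ^ k ∧
      (0 ≤ w → (fwdDiff h)^[k] (truncPow k) w = h ^ k) ∧
      (w + k * h ≤ 0 → (fwdDiff h)^[k] (truncPow k) w = 0) := by
  induction k, hk using Nat.le_induction generalizing w with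
  | base =>
    simp only [Function.iterate_one, fwdDiff, truncPow, pow_one, Nat.factorial_one, Nat.cast_one,
      div_one, one_mul]
    refine ⟨?_, ?_, fun h1 => ?_, fun h1 => ?_⟩
    · exact sub_nonneg.mpr (max_le_max (by linarith) le_rfl)
    · have := max_le (a := w + h) (b := 0) (c := max w 0 + h) (by linarith [le_max_left w 0])
        (by linarith [le_max_right w 0])
      linarith
    · rw [max_eq_left h1, max_eq_left (by linarith)]; ring
    · rw [max_eq_right h1, max_eq_right (by linarith)]; ring
  | succ k hk ih =>
    rw [Function.iterate_succ_apply']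
    have hd := hasDerivAt_fwdDiff_iter (hasDerivAt_truncPow hk) h k
    obtain ⟨c, hc, hc2⟩ := exists_hasDerivAt_eq_slope _ _ (show w < w + h by linarith)
      (HasDerivAt.continuousOn fun x _ => hd x) (fun x _ => hd x)
    have hc3 : fwdDiff h ((fwdDiff h)^[k] (truncPow (k + 1))) w = h * (fwdDiff h)^[k] (truncPow k) c := by
      rw [hc2, fwdDiff, add_sub_cancel_left, mul_div_cancel₀ _ hh.ne']
    obtain ⟨i1, i2, i3, i4⟩ := ih c
    rw [hc3, pow_succ]
    refine ⟨by positivity, by nlinarith, fun h1 => ?_, fun h1 => ?_⟩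
    · rw [i3 (by linarith [hc.1])]; ring
    · push_cast at h1
      rw [i4 (by nlinarith [hc.2]), mul_zero]

end Differences

section Smoothing

variable {ι : Type*} [Fintype ι]

/-- The `k`-th difference in `Λ`, with step `h`, of `(Λ - |x|²)₊ ^ (k + s) / (k + s)!`. -/
noncomputable def smoothBall (k s : ℕ) (h Λ : ℝ) (x : ι → ℝ) : ℝ :=
  (fwdDiff h)^[k] (fun L => truncPow (k + s) (L - ∑ i, x i ^ 2)) Λ

lemma smoothBall_eq_sum (k s : ℕ) (h Λ : ℝ) (x : ι → ℝ) :
    smoothBall k s h Λ x = ∑ l ∈ range (k + 1), ((-1 : ℝ) ^ (k - l) * k.choose l) *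
      truncPow (k + s) (Λ + l * h - ∑ i, x i ^ 2) := by
  rw [smoothBall, fwdDiff_iter_eq_sum_shift]
  refine Finset.sum_congr rfl fun l _ => ?_
  rw [zsmul_eq_mul, nsmul_eq_mul]
  push_cast
  rfl

lemma smoothBall_zero_eq (k : ℕ) (h Λ : ℝ) (x : ι → ℝ) :
    smoothBall k 0 h Λ x = (fwdDiff h)^[k] (truncPow k) (Λ - ∑ i, x i ^ 2) := by
  have := fwdDiff_iter_comp_add (h := h) (truncPow k) (-∑ i, x i ^ 2) k Λ
  simpa only [smoothBall, sub_eq_add_neg, add_zero] using this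

lemma continuous_smoothBall (k s : ℕ) (h Λ : ℝ) :
    Continuous (smoothBall k s h Λ : (ι → ℝ) → ℝ) := by
  have : (smoothBall k s h Λ : (ι → ℝ) → ℝ) = _ := funext (smoothBall_eq_sum k s h Λ)
  rw [this]
  refine continuous_finsetSum _ fun l _ => continuous_const.mul ?_
  exact (continuous_truncPow _).comp (by fun_prop)

lemma hasCompactSupport_truncPow {j : ℕ} (hj : 1 ≤ j) (L : ℝ) :
    HasCompactSupport fun x : ι → ℝ => truncPow j (L - ∑ i, x i ^ 2) := by
  have := (hasCompactSupport_max_sub_sum_sq_pow (ι := ι) hj L).mul_right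
    (f' := fun _ => ((j.factorial : ℝ))⁻¹)
  exact this

lemma hasCompactSupport_smoothBall {k s : ℕ} (hk : 1 ≤ k) (h Λ : ℝ) :
    HasCompactSupport (smoothBall k s h Λ : (ι → ℝ) → ℝ) := by
  have : (smoothBall k s h Λ : (ι → ℝ) → ℝ) = _ := funext (smoothBall_eq_sum k s h Λ)
  rw [this]
  have key : ∀ S : Finset ℕ, HasCompactSupport fun x : ι → ℝ => ∑ l ∈ S,
      ((-1 : ℝ) ^ (k - l) * k.choose l) * truncPow (k + s) (Λ + l * h - ∑ i, x i ^ 2) := by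
    intro S
    induction S using Finset.cons_induction with
    | empty => simpa using! HasCompactSupport.zero
    | cons a S ha ih =>
      simp only [Finset.sum_cons]
      exact HasCompactSupport.add ((hasCompactSupport_truncPow (by omega) _).mul_left) ih
  exact key _

lemma hasLineDerivAt_smoothBall [DecidableEq ι] {k s : ℕ} (hk : 1 ≤ k) (h Λ : ℝ) (x : ι → ℝ)
    (i : ι) :
    HasLineDerivAt ℝ (smoothBall k (s + 1) h Λ) (-2 * x i * smoothBall k s h Λ x) x
      (Pi.single i 1) := by
  have h1 : ∀ L : ℝ, HasDerivAt (fun t : ℝ => L - ∑ j, (x + t • (Pi.single i 1 : ι → ℝ)) j ^ 2)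
      (-2 * x i) 0 := fun L => by
    have h2 : ∀ j, HasDerivAt (fun t : ℝ => (x + t • (Pi.single i 1 : ι → ℝ)) j ^ 2)
        (2 * x j * (Pi.single i 1 : ι → ℝ) j) 0 := fun j => by
      have := (((hasDerivAt_id (0:ℝ)).mul_const ((Pi.single i 1 : ι → ℝ) j)).const_add
        (x j)).pow 2
      simpa using! this
    have h3 := (HasDerivAt.fun_sum (u := Finset.univ) fun j _ => h2 j).const_sub L
    refine h3.congr_deriv ?_
    simp [Pi.single_apply]
  have h4 : ∀ L : ℝ, HasDerivAt (fun t : ℝ => truncPow (k + (s + 1))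
      (L - ∑ j, (x + t • (Pi.single i 1 : ι → ℝ)) j ^ 2))
      (truncPow (k + s) (L - ∑ j, x j ^ 2) * (-2 * x i)) 0 := fun L => by
    have h5 := hasDerivAt_truncPow (j := k + s) (by omega)
      (L - ∑ j, (x + (0:ℝ) • (Pi.single i 1 : ι → ℝ)) j ^ 2)
    have h6 := h5.comp (0:ℝ) (h1 L)
    simpa using! h6
  unfold HasLineDerivAt
  simp only [smoothBall_eq_sum]
  have h7 := HasDerivAt.fun_sum (u := range (k + 1)) fun l _ =>
    (h4 (Λ + l * h)).const_mul ((-1 : ℝ) ^ (k - l) * k.choose l)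
  refine h7.congr_deriv ?_
  rw [Finset.mul_sum]
  refine Finset.sum_congr rfl fun l _ => by ring

lemma piFourier_smoothBall {k s : ℕ} (hk : 1 ≤ k) (h Λ : ℝ) (ξ : ι → ℝ) :
    piFourier (smoothBall k s h Λ) ξ =
      (fwdDiff h)^[k] (fun L => piFourier (fun x => truncPow (k + s) (L - ∑ i, x i ^ 2)) ξ) Λ := by
  rw [fwdDiff_iter_eq_sum_shift]
  simp only [piFourier, smoothBall_eq_sum, Complex.ofReal_sum, Finset.mul_sum]
  rw [integral_finsetSum]
  · refine Finset.sum_congr rfl fun l _ => ?_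
    rw [zsmul_eq_mul, nsmul_eq_mul, ← integral_const_mul]
    refine integral_congr_ae (Eventually.of_forall fun x => ?_)
    push_cast
    ring
  · intro l _
    have := (integrable_piFourier (ι := ι) (F := fun x => truncPow (k + s) (Λ + l * h - ∑ i, x i ^ 2))
      ((continuous_truncPow _).comp (by fun_prop))
      (hasCompactSupport_truncPow (by omega) _) ξ).const_mul
        ((((-1 : ℝ) ^ (k - l) * k.choose l : ℝ)) : ℂ)
    refine this.congr (Eventually.of_forall fun x => ?_)
    push_cast
    simp only [Finset.mul_sum]
    ring

end Smoothing

lemma piFourier_const_mul {ι : Type*} [Fintype ι] (c : ℝ) (F : (ι → ℝ) → ℝ) (ξ : ι → ℝ) :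
    piFourier (fun x => c * F x) ξ = c * piFourier F ξ := by
  rw [piFourier, piFourier, ← integral_const_mul]
  refine integral_congr_ae (Eventually.of_forall fun x => ?_)
  simp only; push_cast; ring

section Monomials

variable {ι : Type*} [Fintype ι] [DecidableEq ι]

lemma piFourier_lineDeriv {G G' : (ι → ℝ) → ℝ} (hG : Continuous G) (hG' : Continuous G')
    (hs : HasCompactSupport G) (hs' : HasCompactSupport G') (i : ι)
    (hd : ∀ x, HasLineDerivAt ℝ G (G' x) x (Pi.single i 1)) (ξ : ι → ℝ) :
    piFourier G' ξ = 2 * Real.pi * Complex.I * ξ i * piFourier G ξ := by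
  have hder : ∀ x : ι → ℝ, HasLineDerivAt ℝ
      (fun x : ι → ℝ => Complex.exp (-(2 * Real.pi * Complex.I * ∑ j, (ξ j : ℂ) * (x j : ℂ))))
      (-(2 * Real.pi * Complex.I * ξ i) *
        Complex.exp (-(2 * Real.pi * Complex.I * ∑ j, (ξ j : ℂ) * (x j : ℂ)))) x
      (Pi.single i 1) := fun x => by
    unfold HasLineDerivAt
    have h1 : ∀ t : ℝ, ∑ j, (ξ j : ℂ) * (((x + t • (Pi.single i 1 : ι → ℝ)) j : ℝ) : ℂ) =
        ∑ j, (ξ j : ℂ) * (x j : ℂ) + t * ξ i := fun t => by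
      simp [Pi.single_apply, mul_add, Finset.sum_add_distrib, apply_ite Complex.ofReal, mul_comm]
    simp only [h1]
    have h2 : HasDerivAt (fun t : ℝ => -(2 * Real.pi * Complex.I *
        (∑ j, (ξ j : ℂ) * (x j : ℂ) + (t : ℂ) * ξ i))) (-(2 * Real.pi * Complex.I * ξ i)) 0 := by
      have := ((((hasDerivAt_id (0:ℝ)).ofReal_comp.mul_const (ξ i : ℂ)).const_add
        (∑ j, (ξ j : ℂ) * (x j : ℂ))).const_mul (2 * Real.pi * Complex.I)).neg
      simpa using! this
    have h3 := h2.cexp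
    refine h3.congr_deriv ?_
    simp only [Complex.ofReal_zero, zero_mul, add_zero]
    ring
  have := integral_bilinear_hasLineDerivAt_right_eq_neg_left_of_integrable
    (μ := (volume : Measure (ι → ℝ))) (B := ContinuousLinearMap.mul ℝ ℂ)
    (f := fun x : ι → ℝ => Complex.exp (-(2 * Real.pi * Complex.I * ∑ j, (ξ j : ℂ) * (x j : ℂ))))
    (g := fun x => (G x : ℂ)) (g' := fun x => (G' x : ℂ)) (v := Pi.single i 1)
    ?_ (integrable_piFourier hG' hs' ξ) (integrable_piFourier hG hs ξ) (fun x _ => hder x)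
    (fun x _ => by
      have := HasDerivAt.ofReal_comp (hd x)
      exact this)
  · simp only [ContinuousLinearMap.mul_apply'] at this
    rw [piFourier, this, piFourier, ← integral_const_mul, ← integral_neg]
    refine integral_congr_ae (Eventually.of_forall fun x => ?_)
    simp only
    ring
  · have := (integrable_piFourier hG hs ξ).const_mul (-(2 * Real.pi * Complex.I * ξ i))
    refine this.congr (Eventually.of_forall fun x => ?_)
    simp only [ContinuousLinearMap.mul_apply']
    ring

/-- A family of continuous compactly supported functions with `∂ᵢ V (s + 1) = -2 xᵢ V s`. -/
structure IsDescending (V : ℕ → (ι → ℝ) → ℝ) : Prop where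
  continuous : ∀ s, Continuous (V s)
  hasCompactSupport : ∀ s, HasCompactSupport (V s)
  hasLineDerivAt : ∀ s x i, HasLineDerivAt ℝ (V (s + 1)) (-2 * x i * V s x) x (Pi.single i 1)

lemma isDescending_smoothBall {k : ℕ} (hk : 1 ≤ k) (h Λ : ℝ) :
    IsDescending (ι := ι) fun s => smoothBall k s h Λ where
  continuous s := continuous_smoothBall k s h Λ
  hasCompactSupport _ := hasCompactSupport_smoothBall hk h Λ
  hasLineDerivAt _ x i := hasLineDerivAt_smoothBall hk h Λ x i

lemma hasLineDerivAt_monomial (e : ι → ℕ) (x : ι → ℝ) (i : ι) :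
    HasLineDerivAt ℝ (fun x : ι → ℝ => ∏ j, x j ^ e j)
      (e i * ∏ j, x j ^ (Function.update e i (e i - 1)) j) x (Pi.single i 1) := by
  unfold HasLineDerivAt
  have h1 : ∀ t : ℝ, ∏ j, (x + t • (Pi.single i 1 : ι → ℝ)) j ^ e j =
      (x i + t) ^ e i * ∏ j ∈ univ.erase i, x j ^ e j := fun t => by
    rw [← Finset.mul_prod_erase univ _ (Finset.mem_univ i)]
    congr 1
    · simp
    · refine Finset.prod_congr rfl fun j hj => ?_
      simp [Finset.ne_of_mem_erase hj]
  have h2 : ∏ j, x j ^ (Function.update e i (e i - 1)) j =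
      x i ^ (e i - 1) * ∏ j ∈ univ.erase i, x j ^ e j := by
    rw [← Finset.mul_prod_erase univ _ (Finset.mem_univ i)]
    congr 1
    · simp
    · refine Finset.prod_congr rfl fun j hj => ?_
      simp [Finset.ne_of_mem_erase hj]
  simp only [h1, h2]
  have := ((((hasDerivAt_id (0:ℝ)).const_add (x i)).pow (e i)).mul_const
    (∏ j ∈ univ.erase i, x j ^ e j))
  refine this.congr_deriv ?_
  simp [mul_assoc]

lemma piFourier_mul_monomial {V : ℕ → (ι → ℝ) → ℝ} (hV : IsDescending V) (e : ι → ℕ) (i : ι)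
    (s : ℕ) (ξ : ι → ℝ) :
    piFourier (fun x => (x i * ∏ j, x j ^ e j) * V s x) ξ =
      (e i / 2 : ℝ) * piFourier (fun x => (∏ j, x j ^ (Function.update e i (e i - 1)) j) * V (s + 1) x) ξ
        - Real.pi * Complex.I * ξ i * piFourier (fun x => (∏ j, x j ^ e j) * V (s + 1) x) ξ := by
  have hc : ∀ e : ι → ℕ, Continuous fun x : ι → ℝ => ∏ j, x j ^ e j := fun e => by fun_prop
  have h1 := piFourier_lineDeriv (G := fun x => (∏ j, x j ^ e j) * V (s + 1) x)
    (G' := fun x => e i * (∏ j, x j ^ (Function.update e i (e i - 1)) j) * V (s + 1) x +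
      (∏ j, x j ^ e j) * (-2 * x i * V s x))
    ((hc e).mul (hV.continuous _))
    (((continuous_const.mul (hc _)).mul (hV.continuous _)).add
      ((hc e).mul ((by fun_prop : Continuous fun x : ι → ℝ => -2 * x i).mul (hV.continuous _))))
    ((hV.hasCompactSupport _).mul_left)
    (((hV.hasCompactSupport _).mul_left).add (((hV.hasCompactSupport _).mul_left).mul_left)) i
    (fun x => by
      have := HasDerivAt.mul (hasLineDerivAt_monomial e x i) (hV.hasLineDerivAt s x i)
      simpa using! this) ξ
  have h2 : piFourier (fun x => e i * (∏ j, x j ^ (Function.update e i (e i - 1)) j) * V (s + 1) x +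
      (∏ j, x j ^ e j) * (-2 * x i * V s x)) ξ =
      e i * piFourier (fun x => (∏ j, x j ^ (Function.update e i (e i - 1)) j) * V (s + 1) x) ξ
      - 2 * piFourier (fun x => (x i * ∏ j, x j ^ e j) * V s x) ξ := by
    unfold piFourier
    rw [← integral_const_mul, ← integral_const_mul, ← integral_sub]
    · refine integral_congr_ae (Eventually.of_forall fun x => ?_)
      simp only; push_cast; ring
    · exact (integrable_piFourier ((hc _).mul (hV.continuous _))
        (hV.hasCompactSupport _).mul_left ξ).const_mul _
    · exact (integrable_piFourier (((continuous_apply i).mul (hc _)).mul (hV.continuous _))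
        (hV.hasCompactSupport _).mul_left ξ).const_mul _
  rw [h2] at h1
  push_cast
  linear_combination (-1 / 2 : ℂ) * h1

lemma exists_piFourier_monomial_bound (D : ℕ) : ∀ e : ι → ℕ, ∑ j, e j ≤ D → ∃ C : ℝ, 0 ≤ C ∧
    ∀ V : ℕ → (ι → ℝ) → ℝ, IsDescending V → ∀ s (ξ : ι → ℝ), 1 ≤ ‖ξ‖ →
      ‖piFourier (fun x => (∏ j, x j ^ e j) * V s x) ξ‖ ≤
        C * ∑ l ∈ range (D + 1), ‖ξ‖ ^ l * ‖piFourier (V (s + l)) ξ‖ := by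
  induction D with
  | zero =>
    intro e he
    have : ∀ j, e j = 0 := by simpa using he
    exact ⟨1, zero_le_one, fun V _ s ξ _ => by simp [this]⟩
  | succ D ih =>
    intro e he
    by_cases h0 : ∃ i, e i ≠ 0
    · obtain ⟨i, hi⟩ := h0
      set e' := Function.update e i (e i - 1) with he'
      have hsum : ∀ f : ι → ℕ, ∑ j, f j = f i + ∑ j ∈ univ.erase i, f j := fun f =>
        (Finset.add_sum_erase univ f (Finset.mem_univ i)).symm
      have hupd : ∀ (f : ι → ℕ) a, ∑ j ∈ univ.erase i, Function.update f i a j =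
          ∑ j ∈ univ.erase i, f j := fun f a => Finset.sum_congr rfl fun j hj => by
        simp [Finset.ne_of_mem_erase hj]
      have hd1 : ∑ j, e' j ≤ D := by
        rw [hsum] at he ⊢
        rw [he', hupd, Function.update_self]; omega
      have hd2 : ∑ j, Function.update e' i (e' i - 1) j ≤ D := by
        rw [hsum] at hd1 ⊢
        rw [hupd, Function.update_self]; omega
      obtain ⟨C₁, hC₁, h₁⟩ := ih _ hd1
      obtain ⟨C₂, hC₂, h₂⟩ := ih _ hd2
      refine ⟨e' i / 2 * C₂ + Real.pi * C₁, by positivity, fun V hV s ξ hξ => ?_⟩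
      have hmono : (fun x : ι → ℝ => (∏ j, x j ^ e j) * V s x) =
          fun x => (x i * ∏ j, x j ^ e' j) * V s x := by
        ext x
        congr 1
        rw [← Finset.mul_prod_erase univ _ (Finset.mem_univ i),
          ← Finset.mul_prod_erase univ (fun j => x j ^ e' j) (Finset.mem_univ i), ← mul_assoc,
          he', Function.update_self, ← pow_succ', Nat.sub_add_cancel (by omega)]
        congr 1
        refine Finset.prod_congr rfl fun j hj => ?_
        simp [Finset.ne_of_mem_erase hj]
      set S := ∑ l ∈ range (D + 1), ‖ξ‖ ^ l * ‖piFourier (V (s + 1 + l)) ξ‖ with hS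
      have hS0 : 0 ≤ S := Finset.sum_nonneg fun l _ => by positivity
      have hS2 : ‖ξ‖ * S ≤ ∑ l ∈ range (D + 1 + 1), ‖ξ‖ ^ l * ‖piFourier (V (s + l)) ξ‖ := by
        rw [Finset.sum_range_succ' _ (D + 1), hS, Finset.mul_sum]
        refine (le_of_eq ?_).trans (le_add_of_nonneg_right (by positivity))
        refine Finset.sum_congr rfl fun l _ => ?_
        rw [show s + 1 + l = s + (l + 1) by ring]; ring
      rw [hmono, piFourier_mul_monomial hV]
      refine (norm_sub_le _ _).trans ?_
      have hb1 := h₁ V hV (s + 1) ξ hξ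
      have hb2 := h₂ V hV (s + 1) ξ hξ
      rw [← hS] at hb1 hb2
      rw [norm_mul, norm_mul, norm_mul, norm_mul, Complex.norm_real, Complex.norm_real,
        Complex.norm_real, Complex.norm_I, mul_one, Real.norm_of_nonneg Real.pi_nonneg,
        Real.norm_of_nonneg (by positivity)]
      have hξi : ‖ξ i‖ ≤ ‖ξ‖ := norm_le_pi_norm ξ i
      have hpi := Real.pi_nonneg
      calc _ ≤ (e' i / 2 : ℝ) * (C₂ * S) + Real.pi * ‖ξ‖ * (C₁ * S) := by gcongr
        _ ≤ (e' i / 2 : ℝ) * (C₂ * (‖ξ‖ * S)) + Real.pi * ‖ξ‖ * (C₁ * S) := by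
          gcongr; exact le_mul_of_one_le_left hS0 hξ
        _ = (e' i / 2 * C₂ + Real.pi * C₁) * (‖ξ‖ * S) := by ring
        _ ≤ _ := by gcongr
    · push Not at h0
      refine ⟨1, zero_le_one, fun V _ s ξ _ => ?_⟩
      simp only [h0, pow_zero, Finset.prod_const_one, one_mul]
      rw [Finset.sum_range_succ']
      simp only [pow_zero, one_mul, add_zero]
      exact le_add_of_nonneg_left (Finset.sum_nonneg fun l _ => by positivity)

lemma exists_piFourier_mvPolynomial_bound (p : MvPolynomial ι ℝ) {D : ℕ} (hp : p.totalDegree ≤ D) :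
    ∃ C : ℝ, 0 ≤ C ∧ ∀ V : ℕ → (ι → ℝ) → ℝ, IsDescending V → ∀ s (ξ : ι → ℝ), 1 ≤ ‖ξ‖ →
      ‖piFourier (fun x => MvPolynomial.eval x p * V s x) ξ‖ ≤
        C * ∑ l ∈ range (D + 1), ‖ξ‖ ^ l * ‖piFourier (V (s + l)) ξ‖ := by
  have hdeg : ∀ e ∈ p.support, ∑ j, e j ≤ D := fun e he => by
    have := MvPolynomial.le_totalDegree he
    rw [Finsupp.sum_fintype _ _ (by simp)] at this
    exact this.trans hp
  have hex : ∀ e : ι →₀ ℕ, ∃ C : ℝ, 0 ≤ C ∧ (e ∈ p.support → ∀ V : ℕ → (ι → ℝ) → ℝ,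
      IsDescending V → ∀ s (ξ : ι → ℝ), 1 ≤ ‖ξ‖ →
      ‖piFourier (fun x => (∏ j, x j ^ e j) * V s x) ξ‖ ≤
        C * ∑ l ∈ range (D + 1), ‖ξ‖ ^ l * ‖piFourier (V (s + l)) ξ‖) := fun e => by
    by_cases he : e ∈ p.support
    · obtain ⟨C, hC, h⟩ := exists_piFourier_monomial_bound D e (hdeg e he)
      exact ⟨C, hC, fun _ => h⟩
    · exact ⟨0, le_rfl, fun h => absurd h he⟩
  choose C hC0 hC using hex
  refine ⟨∑ e ∈ p.support, |p.coeff e| * C e, Finset.sum_nonneg fun e _ =>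
    mul_nonneg (abs_nonneg _) (hC0 e), fun V hV s ξ hξ => ?_⟩
  have h1 : piFourier (fun x => MvPolynomial.eval x p * V s x) ξ =
      ∑ e ∈ p.support, ((p.coeff e : ℝ) : ℂ) * piFourier (fun x => (∏ j, x j ^ e j) * V s x) ξ := by
    simp only [← piFourier_const_mul]
    unfold piFourier
    rw [← integral_finsetSum]
    · refine integral_congr_ae (Eventually.of_forall fun x => ?_)
      simp only [MvPolynomial.eval_eq', Finset.sum_mul, Finset.mul_sum, Complex.ofReal_sum, mul_assoc]
    · intro e _
      exact integrable_piFourier (continuous_const.mul ((by fun_prop :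
        Continuous fun x : ι → ℝ => ∏ j, x j ^ e j).mul (hV.continuous s)))
        ((hV.hasCompactSupport s).mul_left.mul_left) ξ
  rw [h1, Finset.sum_mul]
  refine (norm_sum_le _ _).trans (Finset.sum_le_sum fun e he => ?_)
  rw [norm_mul, Complex.norm_real, Real.norm_eq_abs, mul_assoc]
  gcongr
  exact hC e he V hV s ξ hξ

end Monomials

section Decay

lemma piFourier_truncPow (m j : ℕ) (hj : 1 ≤ j) :
    ∃ c : ℝ, ∀ (L : ℝ) (ξ : Fin (m + 1) → ℝ),
      piFourier (fun x => truncPow j (L - ∑ i, x i ^ 2)) ξ =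
        c * besselIntegral ((j : ℝ) + m / 2) (√(∑ i, ξ i ^ 2)) L := by
  refine ⟨(j.factorial : ℝ)⁻¹ * ∫ y : Fin m → ℝ, max (1 - ∑ i, y i ^ 2) 0 ^ j, fun L ξ => ?_⟩
  have h := piFourier_const_mul (j.factorial : ℝ)⁻¹
    (fun x : Fin (m + 1) → ℝ => max (L - ∑ i, x i ^ 2) 0 ^ j) ξ
  rw [piFourier_max_sub_sum_sq_pow m j hj, ← mul_assoc, ← Complex.ofReal_mul] at h
  rw [← h]
  congr 1
  ext x
  rw [truncPow, div_eq_inv_mul]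

lemma norm_le_sqrt_sum_sq {ι : Type*} [Fintype ι] (ξ : ι → ℝ) : ‖ξ‖ ≤ √(∑ i, ξ i ^ 2) := by
  refine (pi_norm_le_iff_of_nonneg (Real.sqrt_nonneg _)).mpr fun i => ?_
  rw [Real.norm_eq_abs, ← Real.sqrt_sq_eq_abs]
  exact Real.sqrt_le_sqrt (Finset.single_le_sum (f := fun i => ξ i ^ 2)
    (fun i _ => sq_nonneg _) (Finset.mem_univ i))

lemma besselIntegral_bound_of_le {μ : ℝ} (hμ : 0 < μ) :
    ∃ C, 0 ≤ C ∧ ∀ R r Λ y : ℝ, 1 ≤ R → R ≤ r → 1 ≤ Λ → y ∈ Set.Icc Λ (2 * Λ) →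
      ‖besselIntegral μ r y‖ ≤ C * (Λ ^ (μ / 2) * R ^ (-(μ + 1))) := by
  obtain ⟨C, hC0, hC⟩ := besselIntegral_bound hμ
  refine ⟨C * 2 ^ (μ / 2), by positivity, fun R r Λ y hR hr hΛ hy => ?_⟩
  refine (hC r y (hR.trans hr) (hΛ.trans hy.1)).trans ?_
  have h1 : y ^ (μ / 2) ≤ 2 ^ (μ / 2) * Λ ^ (μ / 2) := by
    rw [← Real.mul_rpow (by norm_num) (by linarith)]
    exact Real.rpow_le_rpow (by linarith [hy.1]) hy.2 (by positivity)
  have h2 : r ^ (-(μ + 1)) ≤ R ^ (-(μ + 1)) :=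
    Real.rpow_le_rpow_of_nonpos (by linarith) hr (by linarith)
  have h3 : 0 ≤ r ^ (-(μ + 1)) := Real.rpow_nonneg (by linarith) _
  calc _ ≤ C * ((2 ^ (μ / 2) * Λ ^ (μ / 2)) * R ^ (-(μ + 1))) := by gcongr
    _ = _ := by ring

lemma exists_piFourier_smoothBall_bound {m k : ℕ} (hm : 1 ≤ m) (hk : 1 ≤ k) (s : ℕ) :
    ∃ C : ℝ, 0 ≤ C ∧ ∀ (h Λ : ℝ) (ξ : Fin (m + 1) → ℝ), 0 < h → k * h ≤ Λ → 1 ≤ Λ → 1 ≤ ‖ξ‖ →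
      ‖piFourier (smoothBall k s h Λ) ξ‖ ≤ C * h ^ k * (Λ ^ (((s : ℝ) + m / 2) / 2) *
        ‖ξ‖ ^ (-((s : ℝ) + m / 2 + 1)) * min 1 ((√Λ / h / ‖ξ‖) ^ k)) := by
  have hm' : (1:ℝ) ≤ m := by exact_mod_cast hm
  obtain ⟨c, hc⟩ := piFourier_truncPow m (k + s) (by omega)
  obtain ⟨C₁, hC₁, h₁⟩ := besselIntegral_bound_of_le (μ := (s : ℝ) + m / 2) (by positivity)
  obtain ⟨C₂, hC₂, h₂⟩ := besselIntegral_bound_of_le (μ := ((k + s : ℕ) : ℝ) + m / 2) (by positivity)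
  set P := ∏ j ∈ range k, |(j : ℝ) + s + m / 2 + 1| with hP
  have hP0 : 0 ≤ P := Finset.prod_nonneg fun _ _ => abs_nonneg _
  refine ⟨|c| * (P * C₁ + 2 ^ k * C₂), by positivity, fun h Λ ξ hh hkh hΛ hξ => ?_⟩
  have hΛ0 : 0 < Λ := by linarith
  have hξ0 : 0 < ‖ξ‖ := by linarith
  set r := √(∑ i, ξ i ^ 2) with hr
  have hrξ : ‖ξ‖ ≤ r := norm_le_sqrt_sum_sq ξ
  have hFT : ‖piFourier (smoothBall k s h Λ) ξ‖ =
      |c| * ‖(fwdDiff h)^[k] (besselIntegral (((k + s : ℕ) : ℝ) + m / 2) r) Λ‖ := by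
    rw [piFourier_smoothBall hk]
    simp only [hc]
    have : (fun L : ℝ => (c : ℂ) * besselIntegral (((k + s : ℕ) : ℝ) + m / 2) r L) =
      (c : ℂ) • besselIntegral (((k + s : ℕ) : ℝ) + m / 2) r := rfl
    rw [this, fwdDiff_iter_const_smul, Pi.smul_apply, norm_smul, Complex.norm_real, Real.norm_eq_abs]
  have hsub : ∀ y ∈ Set.Icc Λ (Λ + k * h), y ∈ Set.Icc Λ (2 * Λ) := fun y hy =>
    ⟨hy.1, by linarith [hy.2]⟩
  have b1 : ‖(fwdDiff h)^[k] (besselIntegral (((k + s : ℕ) : ℝ) + m / 2) r) Λ‖ ≤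
      P * h ^ k * (C₁ * (Λ ^ (((s : ℝ) + m / 2) / 2) * ‖ξ‖ ^ (-((s : ℝ) + m / 2 + 1)))) := by
    refine norm_fwdDiff_iter_le_of_hasDerivAt
      (fun j => besselIntegral (((j + s : ℕ) : ℝ) + m / 2) r)
      (fun j => (j : ℝ) + s + m / 2 + 1) (fun j x => ?_) hh.le k fun y hy => ?_
    · have := hasDerivAt_besselIntegral (μ := ((j + s : ℕ) : ℝ) + m / 2) (by positivity) r x
      have e1 : ((j + s : ℕ) : ℝ) + m / 2 + 1 = ((j + 1 + s : ℕ) : ℝ) + m / 2 := by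
        push_cast; ring
      rw [e1] at this
      refine this.congr_deriv ?_
      push_cast; ring
    · simp only [zero_add]
      exact h₁ _ _ _ _ hξ hrξ hΛ (hsub y hy)
  have b2 : ‖(fwdDiff h)^[k] (besselIntegral (((k + s : ℕ) : ℝ) + m / 2) r) Λ‖ ≤
      2 ^ k * (C₂ * (Λ ^ ((((k + s : ℕ) : ℝ) + m / 2) / 2) *
        ‖ξ‖ ^ (-(((k + s : ℕ) : ℝ) + m / 2 + 1)))) :=
    norm_fwdDiff_iter_le _ hh.le k fun y hy => h₂ _ _ _ _ hξ hrξ hΛ (hsub y hy)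
  have e2 : Λ ^ ((((k + s : ℕ) : ℝ) + m / 2) / 2) * ‖ξ‖ ^ (-(((k + s : ℕ) : ℝ) + m / 2 + 1)) =
      h ^ k * (Λ ^ (((s : ℝ) + m / 2) / 2) *
        ‖ξ‖ ^ (-((s : ℝ) + m / 2 + 1)) * (√Λ / h / ‖ξ‖) ^ k) := by
    have i1 : (((k + s : ℕ) : ℝ) + m / 2) / 2 = ((s : ℝ) + m / 2) / 2 + 1 / 2 * k := by
      push_cast; ring
    have i2 : -(((k + s : ℕ) : ℝ) + m / 2 + 1) = -((s : ℝ) + m / 2 + 1) - k := by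
      push_cast; ring
    rw [i1, i2, Real.rpow_add hΛ0, Real.rpow_sub hξ0, Real.rpow_mul hΛ0.le, Real.rpow_natCast,
      Real.rpow_natCast, ← Real.sqrt_eq_rpow, div_pow, div_pow]
    field_simp
  rw [e2] at b2
  set A := Λ ^ (((s : ℝ) + m / 2) / 2) * ‖ξ‖ ^ (-((s : ℝ) + m / 2 + 1)) with hA
  have hA0 : 0 ≤ A := by positivity
  set Y := (√Λ / h / ‖ξ‖) ^ k with hY
  have hY0 : 0 ≤ Y := by positivity
  rw [hFT, mul_assoc |c|, mul_assoc |c|]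
  gcongr
  have hh0 : 0 ≤ h ^ k * A := by positivity
  rcases min_choice 1 Y with hmin | hmin <;> rw [hmin]
  · refine b1.trans ?_
    have : 0 ≤ (2 ^ k * C₂) * (h ^ k * A) := by positivity
    nlinarith
  · refine b2.trans ?_
    have : 0 ≤ (P * C₁) * (h ^ k * A * Y) := by positivity
    nlinarith

lemma exists_piFourier_mvPolynomial_smoothBall_bound {m k : ℕ} (hm : 1 ≤ m) (hk : 1 ≤ k)
    (p : MvPolynomial (Fin (m + 1)) ℝ) {D : ℕ} (hp : p.totalDegree ≤ D) :
    ∃ C : ℝ, 0 ≤ C ∧ ∀ (h Λ : ℝ) (ξ : Fin (m + 1) → ℝ), 0 < h → k * h ≤ Λ → 1 ≤ Λ → 1 ≤ ‖ξ‖ →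
      ‖piFourier (fun x => MvPolynomial.eval x p * smoothBall k 0 h Λ x) ξ‖ ≤
        C * h ^ k * Λ ^ ((D : ℝ) / 2 + m / 4) *
          (‖ξ‖ ^ (-((m : ℝ) / 2 + 1)) * min 1 ((√Λ / h / ‖ξ‖) ^ k)) := by
  obtain ⟨C, hC0, hC⟩ := exists_piFourier_mvPolynomial_bound p hp
  choose B hB0 hB using fun s => exists_piFourier_smoothBall_bound hm hk s
  refine ⟨C * ∑ l ∈ range (D + 1), B l, mul_nonneg hC0 (Finset.sum_nonneg fun l _ => hB0 l),
    fun h Λ ξ hh hkh hΛ hξ => ?_⟩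
  have hΛ0 : 0 < Λ := by linarith
  have hξ0 : 0 < ‖ξ‖ := by linarith
  refine (hC _ (isDescending_smoothBall hk h Λ) 0 ξ hξ).trans ?_
  rw [mul_assoc, mul_assoc, mul_assoc]
  gcongr
  rw [Finset.sum_mul]
  refine Finset.sum_le_sum fun l hl => ?_
  rw [zero_add]
  have hl' : (l : ℝ) ≤ D := by exact_mod_cast Nat.lt_succ_iff.mp (Finset.mem_range.mp hl)
  have e1 : ‖ξ‖ ^ l * ‖ξ‖ ^ (-((l : ℝ) + m / 2 + 1)) = ‖ξ‖ ^ (-((m : ℝ) / 2 + 1)) := by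
    rw [← Real.rpow_natCast, ← Real.rpow_add hξ0]; congr 1; ring
  have e2 : Λ ^ (((l : ℝ) + m / 2) / 2) ≤ Λ ^ ((D : ℝ) / 2 + m / 4) :=
    Real.rpow_le_rpow_of_exponent_le hΛ (by linarith)
  set Y := min 1 ((√Λ / h / ‖ξ‖) ^ k) with hY
  have hY0 : 0 ≤ Y := le_min zero_le_one (by positivity)
  have := hB0 l
  calc _ ≤ ‖ξ‖ ^ l * (B l * h ^ k * (Λ ^ (((l : ℝ) + m / 2) / 2) *
        ‖ξ‖ ^ (-((l : ℝ) + m / 2 + 1)) * Y)) := by gcongr; exact hB l h Λ ξ hh hkh hΛ hξ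
    _ = B l * (h ^ k * (Λ ^ (((l : ℝ) + m / 2) / 2) *
        ((‖ξ‖ ^ l * ‖ξ‖ ^ (-((l : ℝ) + m / 2 + 1))) * Y))) := by ring
    _ ≤ _ := by rw [e1]; gcongr

end Decay

section LatticeSum

lemma pow_succ_le_pow_succ_add {a b : ℝ} (hb : 0 ≤ b) (hab : b ≤ a) (m : ℕ) :
    a ^ (m + 1) ≤ b ^ (m + 1) + (m + 1) * (a - b) * a ^ m := by
  induction m with
  | zero => simp
  | succ m ih =>
    have ha : 0 ≤ a := hb.trans hab
    have h1 : b ^ (m + 1) ≤ a ^ (m + 1) := pow_le_pow_left₀ hb hab _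
    have h2 := mul_le_mul_of_nonneg_left ih ha
    have h3 := mul_le_mul_of_nonneg_left h1 (sub_nonneg.mpr hab)
    push_cast
    rw [pow_succ a (m + 1), pow_succ b (m + 1)]
    have h4 : a * ((m + 1) * (a - b) * a ^ m) = (m + 1) * (a - b) * a ^ (m + 1) := by ring
    nlinarith

lemma sum_truncated_weight_le {m : ℕ} (hm : 1 ≤ m) {X : ℝ} (hX : 1 ≤ X) (R : ℕ) :
    ∑ i ∈ range R, ((i + 1 : ℕ) : ℝ) ^ m * (((i + 1 : ℕ) : ℝ) ^ (-((m : ℝ) / 2 + 1)) *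
      min 1 ((X / ((i + 1 : ℕ) : ℝ)) ^ (m + 1))) ≤ 4 * X ^ ((m : ℝ) / 2) := by
  have hX0 : 0 < X := by linarith
  have hm' : (1:ℝ) ≤ m := by exact_mod_cast hm
  have hterm : ∀ i : ℕ, ((i + 1 : ℕ) : ℝ) ^ m * (((i + 1 : ℕ) : ℝ) ^ (-((m : ℝ) / 2 + 1)) *
      min 1 ((X / ((i + 1 : ℕ) : ℝ)) ^ (m + 1))) ≤
      X ^ ((m : ℝ) / 2) * ((2 / √X) * (√(min ((i + 1 : ℕ) : ℝ) X) - √(min (i : ℝ) X)) +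
        (2 * X) * ((max ((i : ℝ) + 1) X)⁻¹ - (max (((i + 1 : ℕ) : ℝ) + 1) X)⁻¹)) := fun i => by
    push_cast
    have hi0 : (0:ℝ) ≤ i := Nat.cast_nonneg i
    set N : ℝ := (i : ℝ) + 1 with hN
    have hN0 : 0 < N := by positivity
    have hiN : (i : ℝ) = N - 1 := by rw [hN]; ring
    have hA : 0 ≤ √(min N X) - √(min (i:ℝ) X) :=
      sub_nonneg.mpr (Real.sqrt_le_sqrt (min_le_min_right _ (by linarith)))
    have hB : 0 ≤ (max N X)⁻¹ - (max (N + 1) X)⁻¹ :=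
      sub_nonneg.mpr (inv_anti₀ (by positivity) (max_le_max_right _ (by linarith)))
    have hs : 0 < √X := Real.sqrt_pos.mpr hX0
    rcases le_or_gt N X with h | h
    · have h1 : N ^ m * N ^ (-((m : ℝ) / 2 + 1)) ≤ X ^ ((m : ℝ) / 2) * (1 / √X * (1 / √N)) := by
        have e1 : N ^ m * N ^ (-((m : ℝ) / 2 + 1)) = N ^ (((m : ℝ) - 1) / 2) * (1 / √N) := by
          rw [← Real.rpow_natCast, ← Real.rpow_add hN0, Real.sqrt_eq_rpow, one_div,
            ← Real.rpow_neg hN0.le, ← Real.rpow_add hN0]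
          congr 1; ring
        have e2 : X ^ ((m : ℝ) / 2) * (1 / √X) = X ^ (((m : ℝ) - 1) / 2) := by
          rw [Real.sqrt_eq_rpow, one_div, ← Real.rpow_neg hX0.le, ← Real.rpow_add hX0]
          congr 1; ring
        rw [e1, ← mul_assoc, e2]
        gcongr
      have h2 : 1 / √N ≤ 2 * (√(min N X) - √(min (i:ℝ) X)) := by
        rw [min_eq_left h, min_eq_left (by linarith)]
        have hsN : 0 < √N := Real.sqrt_pos.mpr hN0
        have s1 := Real.sq_sqrt hN0.le
        have s2 := Real.sq_sqrt hi0
        rw [div_le_iff₀ hsN]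
        nlinarith [sq_nonneg (√N - √(i:ℝ))]
      calc _ ≤ N ^ m * (N ^ (-((m : ℝ) / 2 + 1)) * 1) := by gcongr; exact min_le_left _ _
        _ ≤ X ^ ((m : ℝ) / 2) * (1 / √X * (1 / √N)) := by rw [mul_one]; exact h1
        _ ≤ X ^ ((m : ℝ) / 2) * (1 / √X * (2 * (√(min N X) - √(min (i:ℝ) X)))) := by gcongr
        _ ≤ _ := by
          gcongr
          have : 0 ≤ 2 * X * ((max N X)⁻¹ - (max (N + 1) X)⁻¹) := by positivity
          have e : 1 / √X * (2 * (√(min N X) - √(min (i:ℝ) X))) =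
            2 / √X * (√(min N X) - √(min (i:ℝ) X)) := by ring
          linarith
    · have h1 : N ^ m * (N ^ (-((m : ℝ) / 2 + 1)) * (X / N) ^ (m + 1)) ≤
          X ^ ((m : ℝ) / 2) * (X * (N ^ 2)⁻¹) := by
        have e1 : N ^ m * (N ^ (-((m : ℝ) / 2 + 1)) * (X / N) ^ (m + 1)) =
            X ^ ((m : ℝ) / 2) * X * (X ^ ((m : ℝ) / 2) * (N ^ ((m : ℝ) / 2))⁻¹) * (N ^ 2)⁻¹ := by
          have f1 : X ^ ((m : ℝ) / 2) * X ^ ((m : ℝ) / 2) = X ^ m := by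
            rw [← Real.rpow_add hX0, ← Real.rpow_natCast]; congr 1; ring
          rw [Real.rpow_neg hN0.le, Real.rpow_add hN0, Real.rpow_one, div_pow]
          have hp := (Real.rpow_pos_of_pos hN0 ((m : ℝ) / 2)).ne'
          calc _ = X ^ (m + 1) * (N ^ ((m : ℝ) / 2))⁻¹ * (N ^ 2)⁻¹ := by
                field_simp; ring
            _ = _ := by rw [pow_succ, ← f1]; ring
        rw [e1, mul_assoc, mul_assoc]
        have f2 : X ^ ((m : ℝ) / 2) * (N ^ ((m : ℝ) / 2))⁻¹ ≤ 1 := by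
          rw [← div_eq_mul_inv, div_le_one (by positivity)]
          exact Real.rpow_le_rpow hX0.le h.le (by positivity)
        gcongr
        exact mul_le_of_le_one_left (by positivity) f2
      have h2 : (N ^ 2)⁻¹ ≤ 2 * ((max N X)⁻¹ - (max (N + 1) X)⁻¹) := by
        rw [max_eq_left h.le, max_eq_left (by linarith)]
        have : N⁻¹ - (N + 1)⁻¹ = (N * (N + 1))⁻¹ := by field_simp; ring
        rw [this, inv_le_iff_one_le_mul₀ (by positivity)]
        have e : 2 * (N * (N + 1))⁻¹ * N ^ 2 = 2 * N / (N + 1) := by field_simp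
        rw [e, le_div_iff₀ (by positivity)]
        linarith
      calc _ ≤ N ^ m * (N ^ (-((m : ℝ) / 2 + 1)) * (X / N) ^ (m + 1)) := by
            gcongr; exact min_le_right _ _
        _ ≤ X ^ ((m : ℝ) / 2) * (X * (N ^ 2)⁻¹) := h1
        _ ≤ X ^ ((m : ℝ) / 2) * (X * (2 * ((max N X)⁻¹ - (max (N + 1) X)⁻¹))) := by gcongr
        _ ≤ _ := by
          gcongr
          have : 0 ≤ 2 / √X * (√(min N X) - √(min (i:ℝ) X)) := by positivity
          nlinarith
  refine (Finset.sum_le_sum fun i _ => hterm i).trans ?_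
  rw [← Finset.mul_sum, Finset.sum_add_distrib, ← Finset.mul_sum, ← Finset.mul_sum,
    Finset.sum_range_sub (fun i : ℕ => √(min (i : ℝ) X)),
    Finset.sum_range_sub' (fun i : ℕ => (max ((i : ℝ) + 1) X)⁻¹), mul_comm (4:ℝ)]
  gcongr
  have hs : 0 < √X := Real.sqrt_pos.mpr hX0
  have a1 : √(min (R : ℝ) X) - √(min ((0:ℕ) : ℝ) X) ≤ √X := by
    have := Real.sqrt_le_sqrt (min_le_right (R : ℝ) X)
    have := Real.sqrt_nonneg (min ((0:ℕ) : ℝ) X)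
    linarith
  have a2 : (max (((0:ℕ) : ℝ) + 1) X)⁻¹ - (max ((R : ℝ) + 1) X)⁻¹ ≤ X⁻¹ := by
    have h1 : (max (((0:ℕ) : ℝ) + 1) X)⁻¹ ≤ X⁻¹ := inv_anti₀ hX0 (le_max_right _ _)
    have h2 : 0 ≤ (max ((R : ℝ) + 1) X)⁻¹ := by positivity
    linarith
  calc _ ≤ 2 / √X * √X + 2 * X * X⁻¹ := by gcongr
    _ = 4 := by field_simp; norm_num

lemma norm_intCast_eq_sup {ι : Type*} [Fintype ι] (ξ : ι → ℤ) :
    ‖fun i => (ξ i : ℝ)‖ = ((univ.sup fun i => (ξ i).natAbs : ℕ) : ℝ) := by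
  refine le_antisymm ((pi_norm_le_iff_of_nonneg (Nat.cast_nonneg _)).mpr fun i => ?_) ?_
  · rw [Real.norm_eq_abs, ← Int.cast_abs, Int.abs_eq_natAbs]
    exact_mod_cast Finset.le_sup (f := fun i => (ξ i).natAbs) (Finset.mem_univ i)
  · rcases isEmpty_or_nonempty ι with h | h
    · simp
    · obtain ⟨i, -, hi⟩ := Finset.exists_mem_eq_sup univ Finset.univ_nonempty fun i => (ξ i).natAbs
      rw [hi]
      refine le_trans (le_of_eq ?_) (norm_le_pi_norm (fun i => (ξ i : ℝ)) i)
      rw [Real.norm_eq_abs, ← Int.cast_abs, Int.abs_eq_natAbs]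
      rfl

lemma card_shell_le (m N : ℕ) (S : Finset (Fin (m + 1) → ℤ))
    (hS : ∀ ξ ∈ S, (univ.sup fun i => (ξ i).natAbs) = N + 1) :
    (S.card : ℝ) ≤ 2 * (m + 1) * 3 ^ m * ((N + 1 : ℕ) : ℝ) ^ m := by
  classical
  set B : ℕ → Finset (Fin (m + 1) → ℤ) := fun M => Fintype.piFinset fun _ => Finset.Icc (-(M:ℤ)) M
    with hB
  have hmem : ∀ M ξ, ξ ∈ B M ↔ (univ.sup fun i => (ξ i).natAbs) ≤ M := fun M ξ => by
    simp only [hB, Fintype.mem_piFinset, Finset.mem_Icc, Finset.sup_le_iff, Finset.mem_univ,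
      true_imp_iff]
    exact forall_congr' fun i => by omega
  have hcard : ∀ M, (B M).card = (2 * M + 1) ^ (m + 1) := fun M => by
    simp only [hB, Fintype.card_piFinset_const, Int.card_Icc]
    congr 1; omega
  have hsub : S ⊆ B (N + 1) \ B N := fun ξ hξ => by
    rw [Finset.mem_sdiff, hmem, hmem, hS ξ hξ]; omega
  have hBB : B N ⊆ B (N + 1) := fun ξ hξ => by
    rw [hmem] at hξ ⊢; omega
  have h1 := Finset.card_le_card hsub
  have h2 := Finset.card_sdiff_add_card_eq_card hBB
  rw [hcard, hcard] at h2
  have h3 : (S.card : ℝ) + (2 * (N:ℝ) + 1) ^ (m + 1) ≤ (2 * ((N:ℝ) + 1) + 1) ^ (m + 1) := by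
    exact_mod_cast (by omega :
      S.card + (2 * N + 1) ^ (m + 1) ≤ (2 * (N + 1) + 1) ^ (m + 1))
  have h4 := pow_succ_le_pow_succ_add (a := 2 * ((N:ℝ) + 1) + 1) (b := 2 * (N:ℝ) + 1)
    (by positivity) (by linarith) m
  have h5 : (2 * ((N:ℝ) + 1) + 1) ^ m ≤ (3 * ((N : ℝ) + 1)) ^ m := by
    gcongr; linarith [(Nat.cast_nonneg N : (0:ℝ) ≤ N)]
  rw [mul_pow] at h5
  push_cast
  have h6 : (m + 1 : ℝ) * (2 * ((N:ℝ) + 1) + 1 - (2 * N + 1)) * (2 * ((N:ℝ) + 1) + 1) ^ m =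
    (2 * (m + 1)) * (2 * ((N:ℝ) + 1) + 1) ^ m := by ring
  rw [h6] at h4
  have h7 := mul_le_mul_of_nonneg_left h5 (by positivity : (0:ℝ) ≤ 2 * (m + 1))
  nlinarith

lemma sum_lattice_weight_le {m : ℕ} (hm : 1 ≤ m) {X : ℝ} (hX : 1 ≤ X)
    (S : Finset (Fin (m + 1) → ℤ)) (hS : ∀ ξ ∈ S, ξ ≠ 0) :
    ∑ ξ ∈ S, (‖fun i => (ξ i : ℝ)‖ ^ (-((m : ℝ) / 2 + 1)) *
      min 1 ((X / ‖fun i => (ξ i : ℝ)‖) ^ (m + 1))) ≤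
      8 * (m + 1) * 3 ^ m * X ^ ((m : ℝ) / 2) := by
  classical
  set ν : (Fin (m + 1) → ℤ) → ℕ := fun ξ => univ.sup fun i => (ξ i).natAbs with hν
  have hν0 : ∀ ξ ∈ S, ν ξ ≠ 0 := fun ξ hξ h0 => hS ξ hξ <| by
    ext i
    have := Finset.le_sup (f := fun i => (ξ i).natAbs) (Finset.mem_univ i)
    change _ ≤ ν ξ at this
    simp only [Pi.zero_apply]; omega
  set w : ℕ → ℝ := fun N => (N : ℝ) ^ (-((m : ℝ) / 2 + 1)) * min 1 ((X / (N : ℝ)) ^ (m + 1)) with hw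
  have hw0 : ∀ N, 0 ≤ w N := fun N =>
    mul_nonneg (by positivity) (le_min zero_le_one (by positivity))
  have h1 : ∑ ξ ∈ S, (‖fun i => (ξ i : ℝ)‖ ^ (-((m : ℝ) / 2 + 1)) *
      min 1 ((X / ‖fun i => (ξ i : ℝ)‖) ^ (m + 1))) = ∑ ξ ∈ S, w (ν ξ) :=
    Finset.sum_congr rfl fun ξ _ => by rw [norm_intCast_eq_sup]
  set R := S.sup ν with hR
  have hmaps : ∀ ξ ∈ S, ν ξ - 1 ∈ range R := fun ξ hξ => by
    have := Finset.le_sup (f := ν) hξ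
    have := hν0 ξ hξ
    rw [Finset.mem_range]; omega
  rw [h1, ← Finset.sum_fiberwise_of_maps_to hmaps]
  calc _ ≤ ∑ i ∈ range R, (2 * (m + 1) * 3 ^ m) * (((i + 1 : ℕ) : ℝ) ^ m * w (i + 1)) := by
        refine Finset.sum_le_sum fun i _ => ?_
        have hval : ∀ ξ ∈ S.filter (fun ξ => ν ξ - 1 = i), ν ξ = i + 1 := fun ξ hξ => by
          obtain ⟨h2, h3⟩ := Finset.mem_filter.mp hξ
          have := hν0 ξ h2
          omega
        rw [Finset.sum_congr rfl fun ξ hξ => by rw [hval ξ hξ], Finset.sum_const, nsmul_eq_mul,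
          ← mul_assoc (2 * ((m : ℝ) + 1) * 3 ^ m)]
        exact mul_le_mul_of_nonneg_right (card_shell_le m i _ hval) (hw0 _)
    _ ≤ (2 * (m + 1) * 3 ^ m) * (4 * X ^ ((m : ℝ) / 2)) := by
        rw [← Finset.mul_sum]
        gcongr
        exact sum_truncated_weight_le hm hX R
    _ = _ := by ring

end LatticeSum

section Comparison

lemma norm_sub_le_of_hasSum_of_sum_le {β : Type*} [DecidableEq β] {g : β → ℂ} {a : ℂ}
    (hg : HasSum g a) (b₀ : β) {K : ℝ} (hK : ∀ S : Finset β, b₀ ∉ S → ∑ b ∈ S, ‖g b‖ ≤ K) :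
    ‖a - g b₀‖ ≤ K := by
  have h1 := hg.sub (hasSum_ite_eq b₀ (g b₀))
  refine le_of_tendsto h1.norm (Eventually.of_forall fun S => ?_)
  refine le_trans (le_trans (norm_sum_le _ _) ?_) (hK (S.erase b₀) (Finset.notMem_erase _ _))
  rw [← Finset.sum_erase S (a := b₀) (by simp)]
  refine Finset.sum_le_sum fun i hi => ?_
  rw [if_neg (Finset.ne_of_mem_erase hi), sub_zero]

lemma exists_poisson_bound {m : ℕ} (hm : 1 ≤ m) (p : MvPolynomial (Fin (m + 1)) ℝ) {D : ℕ}
    (hp : p.totalDegree ≤ D) (ρ : Fin (m + 1) → ℝ) :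
    ∃ C : ℝ, 0 ≤ C ∧ ∀ h Λ : ℝ, 0 < h → ((m + 1 : ℕ) : ℝ) * h ≤ Λ → 1 ≤ Λ → h ≤ √Λ →
      |∑' b : Fin (m + 1) → ℤ, (MvPolynomial.eval (fun i => ρ i + b i) p *
          smoothBall (m + 1) 0 h Λ (fun i => ρ i + b i)) -
        ∫ x, MvPolynomial.eval x p * smoothBall (m + 1) 0 h Λ x| ≤
      C * h ^ (m + 1) * Λ ^ ((D : ℝ) / 2 + m / 4) * (√Λ / h) ^ ((m : ℝ) / 2) := by
  classical
  obtain ⟨C, hC0, hC⟩ := exists_piFourier_mvPolynomial_smoothBall_bound hm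
    (show 1 ≤ m + 1 by omega) p hp
  refine ⟨C * (8 * (m + 1) * 3 ^ m), by positivity, fun h Λ hh hkh hΛ hhΛ => ?_⟩
  have hX : 1 ≤ √Λ / h := (one_le_div hh).mpr hhΛ
  set F : (Fin (m + 1) → ℝ) → ℝ := fun x => MvPolynomial.eval x p * smoothBall (m + 1) 0 h Λ x with hF
  have hFc : Continuous F := (MvPolynomial.continuous_eval p).mul (continuous_smoothBall _ _ _ _)
  have hFs : HasCompactSupport F := (hasCompactSupport_smoothBall (by omega) _ _).mul_left
  set K : ℝ := C * (8 * (m + 1) * 3 ^ m) * h ^ (m + 1) * Λ ^ ((D : ℝ) / 2 + m / 4) *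
    (√Λ / h) ^ ((m : ℝ) / 2) with hK
  have hFT : ∀ ξ : Fin (m + 1) → ℤ, ∫ x : Fin (m + 1) → ℝ,
      Complex.exp (-(2 * Real.pi * Complex.I * ∑ i, (ξ i : ℂ) * (x i : ℂ))) * (F x : ℂ) =
      piFourier F fun i => (ξ i : ℝ) := fun ξ => by simp [piFourier]
  have hsumle : ∀ S : Finset (Fin (m + 1) → ℤ), (0 : Fin (m + 1) → ℤ) ∉ S →
      ∑ ξ ∈ S, ‖piFourier F fun i => (ξ i : ℝ)‖ ≤ K := fun S hS => by
    have hne : ∀ ξ ∈ S, ξ ≠ 0 := fun ξ hξ h0 => hS (h0 ▸ hξ)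
    have hnorm : ∀ ξ ∈ S, 1 ≤ ‖fun i => (ξ i : ℝ)‖ := fun ξ hξ => by
      obtain ⟨i, hi⟩ := Function.ne_iff.mp (hne ξ hξ)
      refine le_trans ?_ (norm_le_pi_norm (fun i => (ξ i : ℝ)) i)
      rw [Real.norm_eq_abs]
      exact_mod_cast Int.one_le_abs hi
    calc _ ≤ ∑ ξ ∈ S, C * h ^ (m + 1) * Λ ^ ((D : ℝ) / 2 + m / 4) *
          (‖fun i => (ξ i : ℝ)‖ ^ (-((m : ℝ) / 2 + 1)) *
            min 1 ((√Λ / h / ‖fun i => (ξ i : ℝ)‖) ^ (m + 1))) :=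
          Finset.sum_le_sum fun ξ hξ => hC h Λ _ hh hkh hΛ (hnorm ξ hξ)
      _ ≤ C * h ^ (m + 1) * Λ ^ ((D : ℝ) / 2 + m / 4) *
          (8 * (m + 1) * 3 ^ m * (√Λ / h) ^ ((m : ℝ) / 2)) := by
          rw [← Finset.mul_sum]
          have : 0 ≤ Λ ^ ((D : ℝ) / 2 + m / 4) := Real.rpow_nonneg (by linarith) _
          exact mul_le_mul_of_nonneg_left (sum_lattice_weight_le hm hX S hne) (by positivity)
      _ = K := by rw [hK]; ring
  have hsummable : Summable fun ξ : Fin (m + 1) → ℤ => piFourier F fun i => (ξ i : ℝ) := by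
    refine Summable.of_norm (summable_of_sum_le (c := ‖piFourier F 0‖ + K)
      (fun _ => norm_nonneg _) fun S => ?_)
    have h1 := hsumle (S.erase 0) (Finset.notMem_erase _ _)
    have h2 : ∑ ξ ∈ S, ‖piFourier F fun i => (ξ i : ℝ)‖ ≤
        ∑ ξ ∈ insert 0 (S.erase 0), ‖piFourier F fun i => (ξ i : ℝ)‖ :=
      Finset.sum_le_sum_of_subset_of_nonneg (Finset.insert_erase_subset 0 S)
        fun _ _ _ => norm_nonneg _
    rw [Finset.sum_insert (Finset.notMem_erase _ _)] at h2
    have h3 : (fun i => ((0 : Fin (m + 1) → ℤ) i : ℝ)) = 0 := by ext; simp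
    rw [h3] at h2
    linarith
  have hP := poisson_summation_pi (fun x => (F x : ℂ)) (Complex.continuous_ofReal.comp hFc)
    (hFs.comp_left Complex.ofReal_zero) (by simpa only [hFT] using hsummable) ρ
  simp only [hFT] at hP
  have := norm_sub_le_of_hasSum_of_sum_le hP 0 (K := K) fun S hS => by
    refine le_trans (Finset.sum_le_sum fun ξ _ => ?_) (hsumle S hS)
    rw [norm_mul]
    have h1 := norm_cexp_piFourier (-fun i => (ξ i : ℝ)) ρ
    simp only [Pi.neg_apply, Complex.ofReal_neg, neg_mul, Finset.sum_neg_distrib, mul_neg, neg_neg,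
      Complex.ofReal_intCast] at h1
    rw [h1, mul_one]
  have h0 : piFourier F (fun i => ((0 : Fin (m + 1) → ℤ) i : ℝ)) = ((∫ x, F x : ℝ) : ℂ) := by
    simp [piFourier, integral_complex_ofReal]
  rw [h0, ← Complex.ofReal_tsum] at this
  simp only [Pi.zero_apply, Int.cast_zero, zero_mul, Finset.sum_const_zero, mul_zero,
    Complex.exp_zero, mul_one] at this
  rw [← Complex.ofReal_sub, Complex.norm_real, Real.norm_eq_abs] at this
  exact this

end Comparison

section Tauberian

lemma rpow_sub_rpow_le {e x y : ℝ} (he : 1 ≤ e) (hx : 0 ≤ x) (hy : 0 < y) :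
    y ^ e - x ^ e ≤ e * y ^ (e - 1) * (y - x) := by
  have h1 := one_add_mul_self_le_rpow_one_add (s := x / y - 1)
    (by linarith [div_nonneg hx hy.le]) he
  rw [add_sub_cancel, Real.div_rpow hx hy.le, le_div_iff₀ (Real.rpow_pos_of_pos hy e)] at h1
  have h2 : y ^ e = y ^ (e - 1) * y := by
    rw [Real.rpow_sub_one hy.ne', div_mul_cancel₀ _ hy.ne']
  have h3 : (1 + e * (x / y - 1)) * y ^ e = y ^ e - e * y ^ (e - 1) * (y - x) := by
    rw [h2]; field_simp; ring
  linarith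

lemma isBigO_of_smoothed_bounds {S : ℝ → ℝ} {A C k e a b θ : ℝ} (hA : 0 ≤ A) (hC : 0 ≤ C)
    (hk : 0 ≤ k) (he : 1 ≤ e) (ha : 0 ≤ a) (hb : 0 ≤ b) (hθ : θ < 1 / 2)
    (hS : ∀ h Λ : ℝ, 0 < h → k * h ≤ Λ → 1 ≤ Λ → h ≤ √Λ →
      S Λ ≤ A * (Λ + k * h) ^ e + C * Λ ^ a * (√Λ / h) ^ b ∧
        A * Λ ^ e - C * Λ ^ a * (√Λ / h) ^ b ≤ S (Λ + k * h))
    {α : ℝ} (hα₁ : e - 1 + θ ≤ α) (hα₂ : a + b / 2 - b * θ ≤ α) :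
    (fun Λ => S Λ - A * Λ ^ e) =O[atTop] fun Λ => Λ ^ α := by
  refine IsBigO.of_bound (A * e * 2 ^ (e - 1) * k + C) ?_
  have hev : ∀ᶠ Λ : ℝ in atTop, k + 2 ≤ Λ ^ (1 / 2 - θ) :=
    (tendsto_rpow_atTop (by linarith)).eventually_ge_atTop _
  filter_upwards [hev, eventually_ge_atTop 4] with Λ h1 h4
  have h0 : 0 < Λ := by linarith
  set h := Λ ^ θ with hh
  have hpos : 0 < h := Real.rpow_pos_of_pos h0 _
  have hsq : √Λ = h * Λ ^ (1 / 2 - θ) := by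
    rw [hh, ← Real.rpow_add h0, Real.sqrt_eq_rpow]; congr 1; ring
  have hkh : (k + 2) * h ≤ √Λ := by rw [hsq, mul_comm]; gcongr
  have hs2 : 2 ≤ √Λ := Real.le_sqrt_of_sq_le (by linarith)
  have hss : √Λ * √Λ = Λ := Real.mul_self_sqrt h0.le
  have hkh0 : 0 ≤ k * h := by positivity
  have hkh2 : k * h ≤ Λ / 2 := by nlinarith
  have hE : ∀ M, 0 < M → M ≤ Λ → C * M ^ a * (√M / h) ^ b ≤ C * Λ ^ α := fun M hM hMΛ => by
    calc C * M ^ a * (√M / h) ^ b ≤ C * Λ ^ a * (√Λ / h) ^ b := by gcongr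
      _ = C * Λ ^ (a + b / 2 - b * θ) := by
        rw [hsq, mul_div_cancel_left₀ _ hpos.ne', ← Real.rpow_mul h0.le, mul_assoc,
          ← Real.rpow_add h0]
        congr 2; ring
      _ ≤ C * Λ ^ α := by gcongr; linarith
  have hm1 : Λ ^ (e - 1) * h ≤ Λ ^ α := by
    rw [hh, ← Real.rpow_add h0]
    exact Real.rpow_le_rpow_of_exponent_le (by linarith) hα₁
  have h2e : (1 : ℝ) ≤ 2 ^ (e - 1) := Real.one_le_rpow (by norm_num) (by linarith)
  have hΛα : 0 ≤ Λ ^ α := Real.rpow_nonneg h0.le _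
  rw [Real.norm_eq_abs, Real.norm_eq_abs, abs_of_nonneg hΛα, abs_le]
  constructor
  · have h2 := (hS h (Λ - k * h) hpos (by linarith) (by linarith)
      (Real.le_sqrt_of_sq_le (by nlinarith))).2
    rw [sub_add_cancel] at h2
    have h3 := hE (Λ - k * h) (by linarith) (by linarith)
    have h5 := rpow_sub_rpow_le he (x := Λ - k * h) (by linarith) h0
    have h6 : Λ ^ e - (Λ - k * h) ^ e ≤ e * 2 ^ (e - 1) * k * Λ ^ α := by
      calc _ ≤ e * k * (Λ ^ (e - 1) * h) := h5.trans (by ring_nf; rfl)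
        _ ≤ e * k * Λ ^ α := by gcongr
        _ ≤ e * k * (2 ^ (e - 1) * Λ ^ α) := by gcongr; exact le_mul_of_one_le_left hΛα h2e
        _ = _ := by ring
    nlinarith [mul_le_mul_of_nonneg_left h6 hA]
  · have h2 := (hS h Λ hpos (by linarith) (by linarith) (by nlinarith)).1
    have h3 := hE Λ h0 le_rfl
    have h5 := rpow_sub_rpow_le he h0.le (y := Λ + k * h) (by linarith)
    have h6 : (Λ + k * h) ^ e - Λ ^ e ≤ e * 2 ^ (e - 1) * k * Λ ^ α := by
      calc _ ≤ e * (Λ + k * h) ^ (e - 1) * (k * h) := h5.trans (by ring_nf; rfl)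
        _ ≤ e * (2 * Λ) ^ (e - 1) * (k * h) := by gcongr; linarith
        _ = e * 2 ^ (e - 1) * k * (Λ ^ (e - 1) * h) := by
            rw [Real.mul_rpow (by norm_num) h0.le]; ring
        _ ≤ _ := by gcongr
    nlinarith [mul_le_mul_of_nonneg_left h6 hA]

lemma isBigO_comp_add_const {S : ℝ → ℝ} {A e α : ℝ} (c : ℝ) (hc : 0 ≤ c) (he : 1 ≤ e)
    (hα : e - 1 ≤ α)
    (hS : (fun Λ => S Λ - A * Λ ^ e) =O[atTop] fun Λ => Λ ^ α) :
    (fun Λ => S (Λ + c) - A * Λ ^ e) =O[atTop] fun Λ => Λ ^ α := by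
  have h1 := hS.comp_tendsto (tendsto_atTop_add_const_right atTop c tendsto_id)
  have hα0 : 0 ≤ α := by linarith
  have h2 : (fun Λ : ℝ => (Λ + c) ^ α) =O[atTop] fun Λ => Λ ^ α := by
    refine IsBigO.of_bound (2 ^ α) ?_
    filter_upwards [eventually_ge_atTop c, eventually_gt_atTop 0] with Λ h3 h4
    rw [Real.norm_of_nonneg (by positivity), Real.norm_of_nonneg (by positivity),
      ← Real.mul_rpow (by norm_num) h4.le]
    gcongr; linarith
  have h3 : (fun Λ : ℝ => A * ((Λ + c) ^ e - Λ ^ e)) =O[atTop] fun Λ => Λ ^ α := by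
    refine IsBigO.const_mul_left ?_ A
    refine IsBigO.of_bound (e * 2 ^ (e - 1) * c) ?_
    filter_upwards [eventually_ge_atTop c, eventually_ge_atTop 1] with Λ h3 h4
    have h0 : 0 < Λ := by linarith
    have h5 : Λ ^ e ≤ (Λ + c) ^ e := by gcongr; exact le_add_of_nonneg_right hc
    rw [Real.norm_of_nonneg (by linarith), Real.norm_of_nonneg (by positivity)]
    calc _ ≤ e * (Λ + c) ^ (e - 1) * (Λ + c - Λ) := rpow_sub_rpow_le he h0.le (by linarith)
      _ ≤ e * (2 * Λ) ^ (e - 1) * c := by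
          rw [add_sub_cancel_left]
          gcongr; linarith
      _ = e * 2 ^ (e - 1) * c * Λ ^ (e - 1) := by
          rw [Real.mul_rpow (by norm_num) h0.le]; ring
      _ ≤ _ := by gcongr
  refine ((h1.trans h2).add h3).congr_left fun Λ => ?_
  simp only [Function.comp_apply, id_eq]
  ring

end Tauberian

section Sandwich

variable {ι : Type*} [Fintype ι]

/-- The sum of a polynomial over the points of a shifted lattice in a ball of squared radius `Λ`. -/
noncomputable def ballSum (p : MvPolynomial ι ℝ) (ρ : ι → ℝ) (Λ : ℝ) : ℝ :=
  ∑' b : ι → ℤ, if ∑ i, (ρ i + b i) ^ 2 ≤ Λ then MvPolynomial.eval (fun i => ρ i + b i) p else 0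

/-- The integral of a polynomial over the ball of squared radius `Λ`. -/
noncomputable def ballIntegral (p : MvPolynomial ι ℝ) (Λ : ℝ) : ℝ :=
  ∫ x in {x : ι → ℝ | ∑ i, x i ^ 2 ≤ Λ}, MvPolynomial.eval x p

lemma isCompact_setOf_sum_sq_le (Λ : ℝ) : IsCompact {x : ι → ℝ | ∑ i, x i ^ 2 ≤ Λ} := by
  refine Metric.isCompact_of_isClosed_isBounded
    (isClosed_le (by fun_prop) continuous_const) ?_
  refine (Metric.isBounded_closedBall (x := (0 : ι → ℝ)) (r := √Λ)).subset fun x hx => ?_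
  rw [mem_closedBall_zero_iff]
  exact (norm_le_sqrt_sum_sq x).trans (Real.sqrt_le_sqrt hx)

lemma summable_shift_of_sum_sq {f : (ι → ℝ) → ℝ} {Λ : ℝ} (hf : ∀ x, Λ < ∑ i, x i ^ 2 → f x = 0)
    (ρ : ι → ℝ) : Summable fun b : ι → ℤ => f fun i => ρ i + b i := by
  refine summable_of_hasFiniteSupport ((finite_int_norm_le (‖ρ‖ + √Λ)).subset fun b hb => ?_)
  have h1 : ∑ i, (ρ i + b i) ^ 2 ≤ Λ := by
    by_contra! h
    exact hb (hf _ h)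
  have h2 := (norm_le_sqrt_sum_sq fun i => ρ i + b i).trans (Real.sqrt_le_sqrt h1)
  have h3 : (fun i => (b i : ℝ)) = (fun i => ρ i + b i) - ρ := by ext; simp
  change ‖fun i => (b i : ℝ)‖ ≤ _
  rw [h3]
  exact (norm_sub_le _ _).trans (by linarith)

lemma smoothBall_zero_bounds {k : ℕ} (hk : 1 ≤ k) {h : ℝ} (hh : 0 < h) (Λ : ℝ) (x : ι → ℝ) :
    (if ∑ i, x i ^ 2 ≤ Λ then h ^ k else 0) ≤ smoothBall k 0 h Λ x ∧
      smoothBall k 0 h Λ x ≤ if ∑ i, x i ^ 2 ≤ Λ + k * h then h ^ k else 0 := by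
  obtain ⟨h1, h2, h3, h4⟩ := fwdDiff_iter_truncPow hh k hk (Λ - ∑ i, x i ^ 2)
  rw [smoothBall_zero_eq]
  constructor
  · split_ifs with h5
    · exact (h3 (by linarith)).ge
    · exact h1
  · split_ifs with h5
    · exact h2
    · exact (h4 (by linarith)).le

lemma eval_mul_smoothBall_bounds {p : MvPolynomial ι ℝ} (hp : ∀ x, 0 ≤ MvPolynomial.eval x p)
    {k : ℕ} (hk : 1 ≤ k) {h : ℝ} (hh : 0 < h) (Λ : ℝ) (x : ι → ℝ) :
    h ^ k * (if ∑ i, x i ^ 2 ≤ Λ then MvPolynomial.eval x p else 0) ≤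
        MvPolynomial.eval x p * smoothBall k 0 h Λ x ∧
      MvPolynomial.eval x p * smoothBall k 0 h Λ x ≤
        h ^ k * if ∑ i, x i ^ 2 ≤ Λ + k * h then MvPolynomial.eval x p else 0 := by
  obtain ⟨h1, h2⟩ := smoothBall_zero_bounds hk hh Λ x
  have h3 := mul_le_mul_of_nonneg_left h1 (hp x)
  have h4 := mul_le_mul_of_nonneg_left h2 (hp x)
  simp only [mul_ite, mul_zero] at h3 h4 ⊢
  simp only [mul_comm (h ^ k)]
  exact ⟨h3, h4⟩

lemma ballSum_bounds {p : MvPolynomial ι ℝ} (hp : ∀ x, 0 ≤ MvPolynomial.eval x p)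
    {k : ℕ} (hk : 1 ≤ k) {h : ℝ} (hh : 0 < h) (ρ : ι → ℝ) (Λ : ℝ) :
    h ^ k * ballSum p ρ Λ ≤ ∑' b : ι → ℤ, (MvPolynomial.eval (fun i => ρ i + b i) p *
        smoothBall k 0 h Λ (fun i => ρ i + b i)) ∧
      ∑' b : ι → ℤ, (MvPolynomial.eval (fun i => ρ i + b i) p *
        smoothBall k 0 h Λ (fun i => ρ i + b i)) ≤ h ^ k * ballSum p ρ (Λ + k * h) := by
  have hs : ∀ L : ℝ, Summable fun b : ι → ℤ =>
      h ^ k * (if ∑ i, (ρ i + b i) ^ 2 ≤ L then MvPolynomial.eval (fun i => ρ i + b i) p else 0) :=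
    fun L => summable_shift_of_sum_sq (f := fun x => h ^ k * (if ∑ i, x i ^ 2 ≤ L then
      MvPolynomial.eval x p else 0)) (Λ := L) (fun x hx => by simp [hx.not_ge]) ρ
  have hs' : Summable fun b : ι → ℤ => MvPolynomial.eval (fun i => ρ i + b i) p *
        smoothBall k 0 h Λ (fun i => ρ i + b i) := by
    refine summable_shift_of_sum_sq (f := fun x => MvPolynomial.eval x p * smoothBall k 0 h Λ x)
      (Λ := Λ + k * h) (fun x hx => ?_) ρ
    obtain ⟨h1, h2⟩ := eval_mul_smoothBall_bounds hp hk hh Λ x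
    rw [if_neg hx.not_ge] at h2
    rw [if_neg (by nlinarith [show (0:ℝ) ≤ k * h by positivity])] at h1
    linarith
  rw [ballSum, ballSum, ← tsum_mul_left, ← tsum_mul_left]
  exact ⟨(hs Λ).tsum_le_tsum (fun b => (eval_mul_smoothBall_bounds hp hk hh Λ _).1) hs',
    hs'.tsum_le_tsum (fun b => (eval_mul_smoothBall_bounds hp hk hh Λ _).2) (hs _)⟩

lemma ballIntegral_bounds {p : MvPolynomial ι ℝ} (hp : ∀ x, 0 ≤ MvPolynomial.eval x p)
    {k : ℕ} (hk : 1 ≤ k) {h : ℝ} (hh : 0 < h) (Λ : ℝ) :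
    h ^ k * ballIntegral p Λ ≤ ∫ x, MvPolynomial.eval x p * smoothBall k 0 h Λ x ∧
      ∫ x, MvPolynomial.eval x p * smoothBall k 0 h Λ x ≤
        h ^ k * ballIntegral p (Λ + k * h) := by
  have hm : ∀ L : ℝ, MeasurableSet {x : ι → ℝ | ∑ i, x i ^ 2 ≤ L} := fun L =>
    (isCompact_setOf_sum_sq_le L).measurableSet
  have hb : ∀ L : ℝ, h ^ k * ballIntegral p L =
      ∫ x : ι → ℝ, h ^ k * (if ∑ i, x i ^ 2 ≤ L then MvPolynomial.eval x p else 0) := fun L => by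
    rw [ballIntegral, ← integral_indicator (hm L), ← integral_const_mul]
    rfl
  have hi : ∀ L : ℝ, Integrable fun x : ι → ℝ =>
      h ^ k * (if ∑ i, x i ^ 2 ≤ L then MvPolynomial.eval x p else 0) := fun L => by
    refine Integrable.const_mul ?_ _
    exact (integrable_indicator_iff (hm L)).mpr
      ((MvPolynomial.continuous_eval p).continuousOn.integrableOn_compact
        (isCompact_setOf_sum_sq_le L))
  have hi' : Integrable fun x => MvPolynomial.eval x p * smoothBall k 0 h Λ x :=
    Continuous.integrable_of_hasCompactSupport
      ((MvPolynomial.continuous_eval p).mul (continuous_smoothBall _ _ _ _))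
      ((hasCompactSupport_smoothBall hk _ _).mul_left)
  rw [hb, hb]
  exact ⟨integral_mono (hi _) hi' fun x => (eval_mul_smoothBall_bounds hp hk hh Λ x).1,
    integral_mono hi' (hi _) fun x => (eval_mul_smoothBall_bounds hp hk hh Λ x).2⟩

end Sandwich

section Scaling

lemma eval_smul_of_isHomogeneous {ι : Type*} [Fintype ι] {p : MvPolynomial ι ℝ} {D : ℕ}
    (hp : p.IsHomogeneous D) (c : ℝ) (x : ι → ℝ) :
    MvPolynomial.eval (c • x) p = c ^ D * MvPolynomial.eval x p := by
  rw [MvPolynomial.eval_eq', MvPolynomial.eval_eq', Finset.mul_sum]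
  refine Finset.sum_congr rfl fun d hd => ?_
  have h1 : d.degree = D := by
    by_contra h
    exact MvPolynomial.mem_support_iff.mp hd (hp.coeff_eq_zero h)
  simp only [Pi.smul_apply, smul_eq_mul, mul_pow, Finset.prod_mul_distrib]
  rw [Finset.prod_pow_eq_pow_sum, ← Finsupp.degree_eq_sum, h1]
  ring

lemma ballIntegral_nonneg {ι : Type*} [Fintype ι] {p : MvPolynomial ι ℝ}
    (hp : ∀ x, 0 ≤ MvPolynomial.eval x p) (Λ : ℝ) : 0 ≤ ballIntegral p Λ :=
  integral_nonneg hp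

lemma ballIntegral_eq_rpow_mul {ι : Type*} [Fintype ι] {p : MvPolynomial ι ℝ} {D : ℕ}
    (hp : p.IsHomogeneous D) {Λ : ℝ} (hΛ : 0 < Λ) :
    ballIntegral p Λ = ballIntegral p 1 * Λ ^ (((D : ℝ) + Fintype.card ι) / 2) := by
  have hs : 0 < √Λ := Real.sqrt_pos.mpr hΛ
  have h1 : ∀ L : ℝ, ballIntegral p L =
      ∫ x : ι → ℝ, if ∑ i, x i ^ 2 ≤ L then MvPolynomial.eval x p else 0 := fun L => by
    rw [ballIntegral, ← integral_indicator (isCompact_setOf_sum_sq_le L).measurableSet]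
    rfl
  have h2 := Measure.integral_comp_smul volume
    (fun x : ι → ℝ => if ∑ i, x i ^ 2 ≤ Λ then MvPolynomial.eval x p else 0) √Λ
  have h3 : ∀ x : ι → ℝ, (if ∑ i, (√Λ • x) i ^ 2 ≤ Λ then MvPolynomial.eval (√Λ • x) p else 0) =
      √Λ ^ D * if ∑ i, x i ^ 2 ≤ 1 then MvPolynomial.eval x p else 0 := fun x => by
    have h4 : ∑ i, (√Λ • x) i ^ 2 = Λ * ∑ i, x i ^ 2 := by
      simp [mul_pow, Real.sq_sqrt hΛ.le, Finset.mul_sum]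
    rw [h4, eval_smul_of_isHomogeneous hp, mul_ite, mul_zero]
    refine if_congr ?_ rfl rfl
    rw [mul_le_iff_le_one_right hΛ]
  simp only [h3] at h2
  rw [integral_const_mul, ← h1, ← h1, Module.finrank_fintype_fun_eq_card, smul_eq_mul,
    abs_of_nonneg (by positivity)] at h2
  have h6 : Λ ^ (((D : ℝ) + Fintype.card ι) / 2) = √Λ ^ D * √Λ ^ Fintype.card ι := by
    rw [← pow_add, Real.sqrt_eq_rpow, ← Real.rpow_natCast, ← Real.rpow_mul hΛ.le]
    push_cast; congr 1; ring
  rw [h6]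
  field_simp at h2
  linarith

end Scaling

section Asymptotics

lemma isBigO_ballSum_sub {m : ℕ} (hm : 1 ≤ m) {p : MvPolynomial (Fin (m + 1)) ℝ} {D : ℕ}
    (hhom : p.IsHomogeneous D) (hp : ∀ x, 0 ≤ MvPolynomial.eval x p) (ρ : Fin (m + 1) → ℝ) {α : ℝ}
    (hα : α = ((D : ℝ) + (m + 1 : ℕ)) / 2 - 1 + 1 / ((m : ℝ) + 2)) :
    (fun Λ => ballSum p ρ Λ - ballIntegral p 1 * Λ ^ (((D : ℝ) + (m + 1 : ℕ)) / 2)) =O[atTop]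
      fun Λ => Λ ^ α := by
  obtain ⟨C, hC0, hC⟩ := exists_poisson_bound hm p hhom.totalDegree_le ρ
  have hm' : (1 : ℝ) ≤ m := by exact_mod_cast hm
  refine isBigO_of_smoothed_bounds (k := ((m + 1 : ℕ) : ℝ)) (a := (D : ℝ) / 2 + m / 4)
    (b := (m : ℝ) / 2) (θ := 1 / ((m : ℝ) + 2)) (ballIntegral_nonneg hp 1) hC0 (by positivity) ?_
    (by positivity) (by positivity) ?_ (fun h Λ hh hkh hΛ hhΛ => ?_) hα.ge ?_
  · push_cast
    linarith [show (0 : ℝ) ≤ D by positivity]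
  · rw [div_lt_div_iff₀ (by positivity) (by norm_num)]; linarith
  · have h1 := abs_le.mp (hC h Λ hh hkh hΛ hhΛ)
    have h2 := ballSum_bounds hp (k := m + 1) (by omega) hh ρ Λ
    have h3 := ballIntegral_bounds hp (k := m + 1) (by omega) hh Λ
    have hscale : ∀ L : ℝ, 0 < L → ballIntegral p L =
        ballIntegral p 1 * L ^ (((D : ℝ) + (m + 1 : ℕ)) / 2) := fun L hL => by
      simpa using ballIntegral_eq_rpow_mul hhom hL
    rw [← hscale Λ (by linarith), ← hscale _ (by positivity)]
    have hpos : 0 < h ^ (m + 1) := by positivity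
    constructor <;> refine le_of_mul_le_mul_left ?_ hpos <;> nlinarith
  · rw [hα]
    push_cast
    refine le_of_eq ?_
    field_simp
    ring

end Asymptotics

section Multiplicity

open MvPolynomial in
/-- The numerator of the multiplicity polynomial of the odd orthogonal groups. -/
noncomputable def multPoly (n : ℕ) : MvPolynomial (Fin n) ℝ :=
  (∏ i, X i ^ 2) * ∏ p ∈ Finset.univ.filter (fun p : Fin n × Fin n => p.1 < p.2),
    (X p.1 ^ 2 - X p.2 ^ 2) ^ 2

lemma eval_multPoly {n : ℕ} (x : Fin n → ℝ) :
    MvPolynomial.eval x (multPoly n) = (∏ i, x i ^ 2) *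
      ∏ p ∈ Finset.univ.filter (fun p : Fin n × Fin n => p.1 < p.2),
        (x p.1 ^ 2 - x p.2 ^ 2) ^ 2 := by
  simp [multPoly]

lemma card_filter_fst_lt_snd (n : ℕ) :
    2 * (Finset.univ.filter fun p : Fin n × Fin n => p.1 < p.2).card + n = n ^ 2 := by
  have h1 : (Finset.univ.filter fun p : Fin n × Fin n => p.2 < p.1).card =
      (Finset.univ.filter fun p : Fin n × Fin n => p.1 < p.2).card :=
    Finset.card_equiv (Equiv.prodComm _ _) (by simp)
  have h2 : (Finset.univ.filter fun p : Fin n × Fin n => p.1 = p.2).card = n := by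
    have : (Finset.univ.filter fun p : Fin n × Fin n => p.1 = p.2) =
        Finset.univ.map ⟨fun i : Fin n => (i, i), fun i j h => (Prod.mk.inj h).1⟩ := by
      ext ⟨i, j⟩
      simp only [Finset.mem_filter, Finset.mem_univ, true_and, Finset.mem_map]
      exact ⟨fun h => ⟨i, Prod.ext rfl h⟩, fun ⟨l, hl⟩ => by cases hl; rfl⟩
    rw [this, Finset.card_map, Finset.card_fin]
  have h3 := Finset.card_filter_add_card_filter_not (s := (Finset.univ : Finset (Fin n × Fin n)))
    (fun p => p.1 < p.2)
  have h4 := Finset.card_filter_add_card_filter_not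
    (s := Finset.univ.filter fun p : Fin n × Fin n => ¬ p.1 < p.2) (fun p => p.1 = p.2)
  rw [Finset.filter_filter, Finset.filter_filter] at h4
  have h5 : (Finset.univ.filter fun p : Fin n × Fin n => ¬ p.1 < p.2 ∧ p.1 = p.2) =
      Finset.univ.filter fun p : Fin n × Fin n => p.1 = p.2 := by
    refine Finset.filter_congr fun p _ => ⟨fun h => h.2, fun h => ⟨h.not_lt, h⟩⟩
  have h6 : (Finset.univ.filter fun p : Fin n × Fin n => ¬ p.1 < p.2 ∧ ¬ p.1 = p.2) =
      Finset.univ.filter fun p : Fin n × Fin n => p.2 < p.1 := by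
    refine Finset.filter_congr fun p _ => ?_
    rw [not_lt, lt_iff_le_and_ne, ne_comm]
  rw [h5, h6, h2, h1] at h4
  rw [Finset.card_univ, Fintype.card_prod, Fintype.card_fin] at h3
  rw [sq]
  omega

lemma isHomogeneous_multPoly (n : ℕ) : (multPoly n).IsHomogeneous (2 * n ^ 2) := by
  have h1 : (∏ i : Fin n, (MvPolynomial.X i : MvPolynomial (Fin n) ℝ) ^ 2).IsHomogeneous
      (∑ _i : Fin n, 2) :=
    MvPolynomial.IsHomogeneous.prod _ _ _ fun i _ => MvPolynomial.isHomogeneous_X_pow i 2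
  have h2 : (∏ p ∈ Finset.univ.filter (fun p : Fin n × Fin n => p.1 < p.2),
      ((MvPolynomial.X p.1 : MvPolynomial (Fin n) ℝ) ^ 2 - MvPolynomial.X p.2 ^ 2) ^ 2).IsHomogeneous
        (∑ _p ∈ Finset.univ.filter (fun p : Fin n × Fin n => p.1 < p.2), 2 * 2) :=
    MvPolynomial.IsHomogeneous.prod _ _ _ fun p _ =>
      ((MvPolynomial.isHomogeneous_X_pow _ 2).sub (MvPolynomial.isHomogeneous_X_pow _ 2)).pow 2
  have h3 := h1.mul h2
  have h4 : 2 * n ^ 2 = ∑ _i : Fin n, 2 +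
      ∑ _p ∈ Finset.univ.filter (fun p : Fin n × Fin n => p.1 < p.2), 2 * 2 := by
    rw [Finset.sum_const, Finset.sum_const, Finset.card_univ, Fintype.card_fin, smul_eq_mul,
      smul_eq_mul]
    have := card_filter_fst_lt_snd n
    omega
  rw [h4]
  exact h3

lemma integral_closedBall_one_eq_ballIntegral {n : ℕ} (p : MvPolynomial (Fin n) ℝ) :
    ∫ x in Metric.closedBall (0 : EuclideanSpace ℝ (Fin n)) 1, MvPolynomial.eval (fun i => x i) p =
      ballIntegral p 1 := by
  have h := (PiLp.volume_preserving_toLp (Fin n)).setIntegral_preimage_emb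
    (MeasurableEquiv.toLp 2 (Fin n → ℝ)).measurableEmbedding
    (fun x : EuclideanSpace ℝ (Fin n) => MvPolynomial.eval (fun i => x i) p)
    (Metric.closedBall 0 1)
  rw [← h, ballIntegral]
  congr 2
  ext x
  rw [Set.mem_preimage, mem_closedBall_zero_iff, EuclideanSpace.norm_eq, Real.sqrt_le_one]
  simp

end Multiplicity

/-- **Improved Weyl law for SO(2n+1), n ≥ 2 (Theorem 4.1, odd case).**
With `d = dim SO(2n+1) = n(2n+1)`, `ρ = (n−1/2, …, 1/2)` the half-sum of positive roots,
the multiplicity polynomial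
`m(x) = (∏_i x_i²)∏_{i<l}(x_i²−x_l²)²/((∏_j a_j²)∏_{j<l}(a_j²−a_l²)²)` (`a_j = n−j+1/2`),
and the spectral counting function
`𝓝(λ) = (2ⁿ n!)⁻¹ Σ_{b∈ℤⁿ} m(b+ρ) 1_{|b+ρ|² ≤ λ+|ρ|²}`, one has
`𝓝(λ) = C λ^{d/2} + O(λ^α)` with `C = (2ⁿ n!)⁻¹ ∫_{|x|≤1} m` and
`α = (2n³+3n²−n)/(2(n+1))`; in particular `α < (d−1)/2`, so the
Avakumovic–Hörmander remainder exponent is not sharp. -/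
theorem stmt5 (n : ℕ) (hn : 2 ≤ n) (d : ℕ) (hd : d = n * (2 * n + 1))
    (a : Fin n → ℝ) (ha : ∀ j, a j = (n : ℝ) - (j : ℕ) - 1 / 2)
    (ρ : EuclideanSpace ℝ (Fin n)) (hρ : ∀ j : Fin n, ρ j = (n : ℝ) - (j : ℕ) - 1 / 2)
    (m : EuclideanSpace ℝ (Fin n) → ℝ)
    (hm : ∀ x, m x =
      ((∏ i, x i ^ 2) *
        ∏ p ∈ Finset.univ.filter (fun p : Fin n × Fin n => p.1 < p.2),
          (x p.1 ^ 2 - x p.2 ^ 2) ^ 2) /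
      ((∏ j, a j ^ 2) *
        ∏ p ∈ Finset.univ.filter (fun p : Fin n × Fin n => p.1 < p.2),
          (a p.1 ^ 2 - a p.2 ^ 2) ^ 2))
    (𝓝 : ℝ → ℝ)
    (h𝓝 : ∀ lam : ℝ, 𝓝 lam = (1 / ((2 : ℝ) ^ n * n.factorial)) *
      ∑' b : Fin n → ℤ,
        if ‖((EuclideanSpace.equiv (Fin n) ℝ).symm fun i => (b i : ℝ) + ρ i)‖ ^ 2
            ≤ lam + ‖ρ‖ ^ 2 then
          m ((EuclideanSpace.equiv (Fin n) ℝ).symm fun i => (b i : ℝ) + ρ i) else 0)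
    (C α : ℝ)
    (hC : C = (1 / ((2 : ℝ) ^ n * n.factorial)) *
      ∫ x in Metric.closedBall (0 : EuclideanSpace ℝ (Fin n)) 1, m x)
    (hα : α = (2 * (n : ℝ) ^ 3 + 3 * (n : ℝ) ^ 2 - n) / (2 * ((n : ℝ) + 1))) :
    (fun lam : ℝ => 𝓝 lam - C * lam ^ ((d : ℝ) / 2)) =O[atTop] (fun lam => lam ^ α)
      ∧ α < ((d : ℝ) - 1) / 2 := by
  have hn' : (2 : ℝ) ≤ n := by exact_mod_cast hn
  have hdr : (d : ℝ) = n * (2 * n + 1) := by rw [hd]; push_cast; ring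
  refine ⟨?_, ?_⟩
  · set c : ℝ := (1 / ((2 : ℝ) ^ n * n.factorial)) * ((∏ j, a j ^ 2) *
        ∏ p ∈ Finset.univ.filter (fun p : Fin n × Fin n => p.1 < p.2),
          (a p.1 ^ 2 - a p.2 ^ 2) ^ 2)⁻¹ with hc
    have hm' : ∀ x : EuclideanSpace ℝ (Fin n), m x =
        ((∏ j, a j ^ 2) * ∏ p ∈ Finset.univ.filter (fun p : Fin n × Fin n => p.1 < p.2),
          (a p.1 ^ 2 - a p.2 ^ 2) ^ 2)⁻¹ * MvPolynomial.eval (fun i => x i) (multPoly n) :=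
      fun x => by rw [hm, eval_multPoly, div_eq_inv_mul]
    have hN : ∀ lam, 𝓝 lam = c * ballSum (multPoly n) (fun i => ρ i) (lam + ‖ρ‖ ^ 2) := by
      intro lam
      rw [h𝓝, ballSum, hc, mul_assoc]
      congr 1
      rw [← tsum_mul_left]
      refine tsum_congr fun b => ?_
      rw [hm', EuclideanSpace.norm_sq_eq, mul_ite, mul_zero]
      simp [add_comm]
    have hCeq : C = c * ballIntegral (multPoly n) 1 := by
      simp only [hC, hm']
      rw [integral_const_mul, integral_closedBall_one_eq_ballIntegral, hc, mul_assoc]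
    have hpos : ∀ x, 0 ≤ MvPolynomial.eval x (multPoly n) := fun x => by
      rw [eval_multPoly]
      positivity
    obtain ⟨k, rfl⟩ : ∃ k, n = k + 1 := ⟨n - 1, by omega⟩
    have he : ((2 * (k + 1) ^ 2 : ℕ) + ((k + 1 : ℕ) : ℝ)) / 2 = (d : ℝ) / 2 := by
      rw [hdr]; push_cast; ring
    have hk : (1 : ℝ) ≤ k := by push_cast at hn'; linarith
    have hα' : α = (d : ℝ) / 2 - 1 + 1 / ((k : ℝ) + 2) := by
      rw [hα, hdr]; push_cast; field_simp; ring
    have key := isBigO_ballSum_sub (by omega : 1 ≤ k) (isHomogeneous_multPoly (k + 1)) hpos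
      (fun i => ρ i) (α := α) (by rw [he]; exact hα')
    rw [he] at key
    have key2 := isBigO_comp_add_const (‖ρ‖ ^ 2) (by positivity) (by rw [hdr]; nlinarith)
      (by rw [hα']; linarith [show 0 ≤ 1 / ((k : ℝ) + 2) by positivity]) key
    refine (key2.const_mul_left c).congr_left fun lam => ?_
    rw [hN, hCeq]; ring
  · rw [hα, hdr, div_lt_div_iff₀ (by positivity) (by norm_num)]
    nlinarith
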